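/- arXiv:2412.01184 — 2 statements merged into one kernel-verified Lean document; each statement's English description precedes it below -/
import Mathlib

section
/- Let X be a real Banach space, let L : X → X be a bounded linear operator, and let Q : X → X be a map such that ‖Q(x)‖ ≤ q‖x‖² whenever ‖x‖ ≤ s₀ (for some constants q ≥ 0 and s₀ > 0). Assume L and Q are completely continuous, i.e. continuous and mapping bounded subsets of X to relatively compact subsets. If x₀ ∈ X and 0 < s ≤ s₀ satisfy ‖x₀‖ + ‖L‖·s + q·s² ≤ s, then the fixed point equation x = x₀ + L(x) + Q(x) has a solution x* ∈ X with ‖x*‖ ≤ s. -/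
/-- A finite set `S` is dominant for a family of rankings `r i` if every element lies, for some `i`,
weakly below all elements of `S` in the ranking `r i`. -/
def IsDominant {I α β : Type*} [LinearOrder β] (r : I → α → β) (S : Finset α) : Prop :=
  ∀ y, ∃ i, ∀ x ∈ S, r i y ≤ r i x

namespace IsDominant

variable {I α β : Type*} [LinearOrder β] {r : I → α → β} {S : Finset α}

theorem mono {T : Finset α} (hS : IsDominant r S) (h : T ⊆ S) : IsDominant r T := fun y ↦
  (hS y).imp fun _ hi x hx ↦ hi x (h hx)

/-- In a dominant set with one element less than there are rankings, exactly one pair of rankings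
shares its minimum. -/
theorem exists_argmin [Fintype I] (hr : ∀ i, Function.Injective (r i)) (hS : IsDominant r S)
    (hne : S.Nonempty) (hcard : S.card + 1 = Fintype.card I) :
    ∃ (μ : I → α) (i j : I), (∀ k, μ k ∈ S) ∧ (∀ k, ∀ x ∈ S, r k (μ k) ≤ r k x) ∧ i ≠ j ∧
      μ i = μ j ∧ ∀ k, (k = i ∨ k = j) → ∀ x ∈ S, ∃ l, l ≠ k ∧ μ l = x := by
  choose μ hμS hμ using fun k ↦ S.exists_min_image (r k) hne
  have hsurj : ∀ x ∈ S, ∃ l, μ l = x := fun x hx ↦ by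
    obtain ⟨l, hl⟩ := hS x
    exact ⟨l, hr l (le_antisymm (hμ l x hx) (hl _ (hμS l)))⟩
  obtain ⟨i, -, j, -, hij, he⟩ := Finset.exists_ne_map_eq_of_card_lt_of_maps_to
    (s := (Finset.univ : Finset I)) (t := S) (by rw [Finset.card_univ]; omega) (f := μ)
    (fun k _ ↦ hμS k)
  refine ⟨μ, i, j, hμS, hμ, hij, he, ?_⟩
  rintro k hk x hx
  obtain ⟨l, rfl⟩ := hsurj x hx
  by_cases hlk : l = k
  · rcases hk with rfl | rfl
    · exact ⟨j, hij.symm, by rw [hlk, he]⟩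
    · exact ⟨i, hij, by rw [hlk, he]⟩
  · exact ⟨l, hlk, rfl⟩

section Extension

variable {μ : I → α} {i j k : I} {y : α}

/-- The candidates for replacing the minimum of the ranking `r k`. -/
def Above (r : I → α → β) (μ : I → α) (k : I) (z : α) : Prop :=
  ∀ l, l ≠ k → r l (μ l) < r l z

theorem insert_of_isMax [DecidableEq α] (hS : IsDominant r S) (hμS : ∀ k, μ k ∈ S)
    (hμ : ∀ k, ∀ x ∈ S, r k (μ k) ≤ r k x) (hk : ∀ x ∈ S, ∃ l, l ≠ k ∧ μ l = x)
    (hy : Above r μ k y) (hmax : ∀ z, Above r μ k z → r k z ≤ r k y) :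
    y ∉ S ∧ IsDominant r (insert y S) := by
  refine ⟨fun hyS ↦ ?_, fun z ↦ ?_⟩
  · obtain ⟨l, hl, rfl⟩ := hk y hyS
    exact lt_irrefl _ (hy l hl)
  by_cases hz : Above r μ k z
  · obtain ⟨m, hm⟩ := hS z
    obtain rfl : m = k := by
      by_contra hmk
      exact absurd (hz m hmk) (not_lt.2 (hm _ (hμS m)))
    refine ⟨m, fun x hx ↦ ?_⟩
    rcases Finset.mem_insert.1 hx with rfl | hx
    · exact hmax z hz
    · exact hm x hx
  · simp only [Above, not_forall, not_lt] at hz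
    obtain ⟨l, hl, hlz⟩ := hz
    refine ⟨l, fun x hx ↦ ?_⟩
    rcases Finset.mem_insert.1 hx with rfl | hx
    · exact hlz.trans (hy l hl).le
    · exact hlz.trans (hμ l x hx)

theorem isMax_of_insert [Fintype I] [DecidableEq I] [DecidableEq α]
    (hr : ∀ i, Function.Injective (r i))
    (hcard : S.card + 1 = Fintype.card I) (hμS : ∀ k, μ k ∈ S)
    (hμ : ∀ k, ∀ x ∈ S, r k (μ k) ≤ r k x) (hij : i ≠ j) (he : μ i = μ j)
    (hyS : y ∉ S) (hy : IsDominant r (insert y S)) :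
    ∃ k, (k = i ∨ k = j) ∧ Above r μ k y ∧ ∀ z, Above r μ k z → r k z ≤ r k y := by
  obtain ⟨k, hk⟩ := hy y
  have hcover : ∀ x ∈ S, ∀ l, r l y ≤ r l (μ l) → ∀ m, (∀ z ∈ insert y S, r m x ≤ r m z) →
      m ≠ l ∧ μ m = x := fun x hx l hl m hm ↦ by
    refine ⟨?_, hr m (le_antisymm (hμ m x hx) (hm _ (Finset.mem_insert_of_mem (hμS m))))⟩
    rintro rfl
    have h : x = y := hr m (le_antisymm (hm y (Finset.mem_insert_self _ _)) (hl.trans (hμ m x hx)))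
    exact hyS (h ▸ hx)
  have hky : r k y ≤ r k (μ k) := hk _ (Finset.mem_insert_of_mem (hμS k))
  have hsub : ∀ l, l ≠ k → ¬ r l y ≤ r l (μ l) := fun l hlk hl ↦ by
    have h : S ⊆ ((Finset.univ.erase k).erase l).image μ := fun x hx ↦ by
      obtain ⟨m, hm⟩ := hy x
      have h1 := hcover x hx l hl m hm
      have h2 := hcover x hx k hky m hm
      exact Finset.mem_image.2 ⟨m, by simp [h1.1, h2.1], h1.2⟩
    have h3 := (Finset.card_le_card h).trans Finset.card_image_le
    rw [Finset.card_erase_of_mem (by simp [hlk]), Finset.card_erase_of_mem (Finset.mem_univ _),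
      Finset.card_univ] at h3
    have := Finset.card_pos.2 ⟨_, hμS k⟩
    omega
  refine ⟨k, ?_, fun l hl ↦ not_le.1 (hsub l hl), fun z hz ↦ ?_⟩
  · by_contra! hkij
    have h : S ⊆ ((Finset.univ.erase k).erase i).image μ := fun x hx ↦ by
      obtain ⟨m, hm⟩ := hy x
      have h2 := hcover x hx k hky m hm
      by_cases hmi : m = i
      · exact Finset.mem_image.2 ⟨j, by simp [hij.symm, hkij.2.symm], by rw [← he, ← hmi, h2.2]⟩
      · exact Finset.mem_image.2 ⟨m, by simp [hmi, h2.1], h2.2⟩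
    have h3 := (Finset.card_le_card h).trans Finset.card_image_le
    rw [Finset.card_erase_of_mem (by simp [hkij.1.symm]),
      Finset.card_erase_of_mem (Finset.mem_univ _), Finset.card_univ] at h3
    have := Finset.card_pos.2 ⟨_, hμS k⟩
    omega
  · obtain ⟨m, hm⟩ := hy z
    by_cases hmk : m = k
    · subst hmk
      exact hm y (Finset.mem_insert_self _ _)
    · exact absurd (hz m hmk) (not_lt.2 (hm _ (Finset.mem_insert_of_mem (hμS m))))

open Classical in
theorem card_insert [Fintype I] [DecidableEq I] [Fintype α] [DecidableEq α]
    (hr : ∀ i, Function.Injective (r i)) (hS : IsDominant r S)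
    (hcard : S.card + 1 = Fintype.card I) (hμS : ∀ k, μ k ∈ S)
    (hμ : ∀ k, ∀ x ∈ S, r k (μ k) ≤ r k x) (hij : i ≠ j) (he : μ i = μ j)
    (hk : ∀ k, (k = i ∨ k = j) → ∀ x ∈ S, ∃ l, l ≠ k ∧ μ l = x) :
    (Finset.univ.filter fun y ↦ y ∉ S ∧ IsDominant r (insert y S)).card =
      (if ∃ z, Above r μ i z then 1 else 0) + if ∃ z, Above r μ j z then 1 else 0 := by
  have hone : ∀ k, (Finset.univ.filter fun y ↦ Above r μ k y ∧
      ∀ z, Above r μ k z → r k z ≤ r k y).card = if ∃ z, Above r μ k z then 1 else 0 := fun k ↦ by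
    split_ifs with h
    · obtain ⟨z, hz⟩ := h
      obtain ⟨y, hy, hmax⟩ := (Finset.univ.filter (Above r μ k)).exists_max_image (r k)
        ⟨z, by simpa using hz⟩
      simp only [Finset.mem_filter, Finset.mem_univ, true_and] at hy hmax
      refine Finset.card_eq_one.2 ⟨y, ?_⟩
      ext w
      simp only [Finset.mem_filter, Finset.mem_univ, true_and, Finset.mem_singleton]
      refine ⟨fun hw ↦ hr k (le_antisymm (hmax w hw.1) (hw.2 y hy)), ?_⟩
      rintro rfl
      exact ⟨hy, hmax⟩
    · rw [Finset.card_eq_zero, Finset.filter_eq_empty_iff]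
      exact fun y _ hy ↦ h ⟨y, hy.1⟩
  rw [← hone i, ← hone j, ← Finset.card_union_of_disjoint]
  · congr 1
    ext y
    simp only [Finset.mem_union, Finset.mem_filter, Finset.mem_univ, true_and]
    constructor
    · rintro ⟨hyS, hy⟩
      obtain ⟨k, rfl | rfl, h⟩ := isMax_of_insert hr hcard hμS hμ hij he hyS hy
      exacts [Or.inl h, Or.inr h]
    · rintro (h | h)
      · exact insert_of_isMax hS hμS hμ (hk i (.inl rfl)) h.1 h.2
      · exact insert_of_isMax hS hμS hμ (hk j (.inr rfl)) h.1 h.2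
  · refine Finset.disjoint_left.2 fun y hyi hyj ↦ ?_
    simp only [Finset.mem_filter, Finset.mem_univ, true_and] at hyi hyj
    obtain ⟨m, hm⟩ := hS y
    have := hm _ (hμS m)
    by_cases hmi : m = i
    · exact absurd (hyj.1 m (hmi ▸ hij)) (not_lt.2 this)
    · exact absurd (hyi.1 m hmi) (not_lt.2 this)

end Extension

section Slack

variable {e : I → α}

open Classical in
/-- A dominant set with one element less than there are rankings and with a non-slack element
has exactly two dominant one-point extensions. -/
theorem card_insert_eq_two [Fintype I] [DecidableEq I] [Fintype α] [DecidableEq α]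
    (hr : ∀ i, Function.Injective (r i)) (hS : IsDominant r S)
    (hcard : S.card + 1 = Fintype.card I)
    (heb : ∀ i j x, i ≠ j → x ∉ Set.range e → r i x < r i (e j))
    {x : α} (hxS : x ∈ S) (hx : x ∉ Set.range e) :
    (Finset.univ.filter fun y ↦ y ∉ S ∧ IsDominant r (insert y S)).card = 2 := by
  obtain ⟨μ, i, j, hμS, hμ, hij, he, hk⟩ := exists_argmin hr hS ⟨x, hxS⟩ hcard
  rw [card_insert hr hS hcard hμS hμ hij he hk, if_pos, if_pos]
  · exact ⟨e j, fun l hl ↦ (hμ l x hxS).trans_lt (heb l j x hl hx)⟩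
  · exact ⟨e i, fun l hl ↦ (hμ l x hxS).trans_lt (heb l i x hl hx)⟩

/-- The set of all slack elements but one is dominant. -/
theorem image_erase [Fintype I] [DecidableEq I] [DecidableEq α]
    (hea : ∀ i x, r i (e i) ≤ r i x)
    (heb : ∀ i j x, i ≠ j → x ∉ Set.range e → r i x < r i (e j)) (i₀ : I) :
    IsDominant r ((Finset.univ.erase i₀).image e) := fun z ↦ by
  by_cases hz : z ∈ Set.range e
  · obtain ⟨m, rfl⟩ := hz
    exact ⟨m, fun x _ ↦ hea m x⟩
  · refine ⟨i₀, fun x hx ↦ ?_⟩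
    obtain ⟨m, hm, rfl⟩ := Finset.mem_image.1 hx
    exact (heb i₀ m z (Finset.ne_of_mem_erase hm).symm hz).le

open Classical in
/-- The set of all slack elements but one has exactly one dominant one-point extension. -/
theorem card_insert_image_erase [Fintype I] [DecidableEq I] [Nontrivial I] [Fintype α]
    [DecidableEq α] (hr : ∀ i, Function.Injective (r i))
    (he : Function.Injective e) (hea : ∀ i x, r i (e i) ≤ r i x)
    (heb : ∀ i j x, i ≠ j → x ∉ Set.range e → r i x < r i (e j)) (i₀ : I) :
    (Finset.univ.filter fun y ↦ y ∉ (Finset.univ.erase i₀).image e ∧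
      IsDominant r (insert y ((Finset.univ.erase i₀).image e))).card = 1 := by
  have hS := image_erase hea heb i₀
  have hcard : ((Finset.univ.erase i₀).image e).card + 1 = Fintype.card I := by
    rw [Finset.card_image_of_injective _ he, Finset.card_erase_add_one (Finset.mem_univ _),
      Finset.card_univ]
  obtain ⟨j₀, hj₀⟩ := exists_ne i₀
  obtain ⟨μ, i, j, hμS, hμ, hij, heq, hk⟩ := exists_argmin hr hS
    ⟨e j₀, Finset.mem_image_of_mem _ (by simp [hj₀])⟩ hcard
  have hμe : ∀ l, l ≠ i₀ → μ l = e l := fun l hl ↦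
    hr l (le_antisymm (hμ l _ (Finset.mem_image_of_mem _ (by simp [hl]))) (hea l _))
  have hi₀ : ∃ z, Above r μ i₀ z := ⟨e i₀, fun l hl ↦ by
    rw [hμe l hl]
    exact (hea l _).lt_of_ne fun h ↦ hl (he (hr l h))⟩
  have hother : ∀ j, j ≠ i₀ → μ i₀ = μ j → ¬ ∃ z, Above r μ j z := by
    rintro j hj h ⟨z, hz⟩
    have h0 := hz i₀ hj.symm
    rw [h, hμe j hj] at h0
    by_cases hzr : z ∈ Set.range e
    · obtain ⟨m, rfl⟩ := hzr
      by_cases hm : m = i₀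
      · subst hm
        exact absurd h0 (not_lt.2 (hea _ _))
      by_cases hmj : m = j
      · subst hmj
        exact lt_irrefl _ h0
      have := hz m hmj
      rw [hμe m hm] at this
      exact lt_irrefl _ this
    · exact absurd h0 (not_lt.2 (heb i₀ j z hj.symm hzr).le)
  rw [card_insert hr hS hcard hμS hμ hij heq hk]
  by_cases h1 : i = i₀
  · subst h1
    rw [if_pos hi₀, if_neg (hother j hij.symm heq)]
  by_cases h2 : j = i₀
  · subst h2
    rw [if_pos hi₀, if_neg (hother i hij heq.symm)]
  exact absurd (he ((hμe i h1).symm.trans (heq.trans (hμe j h2)))) hij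

end Slack

end IsDominant

section Scarf

variable {I α : Type*} [Fintype I] [DecidableEq I] [DecidableEq α]

/-- In a set of `card I` elements whose colours are not all of `I`, the number of elements whose
removal leaves exactly the colours other than `i₀` is even. -/
theorem even_card_image_erase (c : α → I) (i₀ : I) {R : Finset α} (hR : R.card = Fintype.card I)
    (hc : R.image c ≠ Finset.univ) :
    Even (R.filter fun x ↦ (R.erase x).image c = Finset.univ.erase i₀).card := by
  rcases (R.filter fun x ↦ (R.erase x).image c = Finset.univ.erase i₀).eq_empty_or_nonempty
    with h | ⟨x, hx⟩
  · simp [h]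
  have hinj : ∀ w ∈ R, (R.erase w).image c = Finset.univ.erase i₀ → Set.InjOn c (R.erase w) :=
    fun w hw h ↦ Finset.injOn_of_card_image_eq (by
      rw [h, Finset.card_erase_of_mem hw, Finset.card_erase_of_mem (Finset.mem_univ _), hR,
        Finset.card_univ])
  obtain ⟨hxR, hx⟩ := Finset.mem_filter.1 hx
  have himg : R.image c = insert (c x) (Finset.univ.erase i₀) := by
    rw [← hx, ← Finset.image_insert, Finset.insert_erase hxR]
  have hcx : c x ≠ i₀ := fun h ↦ hc (by
    rw [himg, h, Finset.insert_erase (Finset.mem_univ _)])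
  have hcx' : c x ∈ (R.erase x).image c := by rw [hx]; simp [hcx]
  obtain ⟨w, hw, hwc⟩ := Finset.mem_image.1 hcx'
  obtain ⟨hwx, hwR⟩ := Finset.mem_erase.1 hw
  have : (R.filter fun x ↦ (R.erase x).image c = Finset.univ.erase i₀) = {x, w} := by
    ext v
    simp only [Finset.mem_filter, Finset.mem_insert, Finset.mem_singleton]
    constructor
    · rintro ⟨hvR, hv⟩
      by_contra! hne
      exact hwx (hinj v hvR hv (by simp [hwR, hne.2.symm]) (by simp [hxR, hne.1.symm]) hwc)
    · rintro (rfl | rfl)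
      · exact ⟨hxR, hx⟩
      · refine ⟨hwR, ?_⟩
        have h1 : R.image c = Finset.univ.erase i₀ := by
          rw [himg, Finset.insert_eq_of_mem (by simp [hcx])]
        rw [← h1, ← Finset.insert_erase hwR, Finset.image_insert, Finset.erase_insert (by simp),
          Finset.insert_eq_of_mem]
        rw [hwc]
        exact Finset.mem_image_of_mem _ (by simp [hxR, hwx.symm])
  rw [this, Finset.card_pair hwx.symm]
  exact even_two

open Classical in
/-- **Scarf's lemma** for rankings with slack elements: there is a dominant set of all colours. -/
theorem exists_isDominant_image_eq_univ {β : Type*} [LinearOrder β] [Nontrivial I] [Fintype α]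
    {r : I → α → β}
    (hr : ∀ i, Function.Injective (r i)) {e : I → α} (hea : ∀ i x, r i (e i) ≤ r i x)
    (heb : ∀ i j x, i ≠ j → x ∉ Set.range e → r i x < r i (e j))
    {c : α → I} (hce : ∀ i, c (e i) = i) :
    ∃ R, IsDominant r R ∧ R.image c = Finset.univ := by
  by_contra! hcon
  have he : Function.Injective e := Function.LeftInverse.injective hce
  obtain ⟨i₀⟩ : Nonempty I := inferInstance
  set D : Finset (Finset α) := Finset.univ.filter fun S ↦
    S.card + 1 = Fintype.card I ∧ IsDominant r S ∧ S.image c = Finset.univ.erase i₀ with hD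
  set E : Finset (Finset α) := Finset.univ.filter fun R ↦
    R.card = Fintype.card I ∧ IsDominant r R with hE
  have hcount : ∑ S ∈ D, (Finset.univ.filter fun y ↦ y ∉ S ∧ IsDominant r (insert y S)).card =
      ∑ R ∈ E, (R.filter fun x ↦ (R.erase x).image c = Finset.univ.erase i₀).card := by
    rw [← Finset.card_sigma, ← Finset.card_sigma]
    refine Finset.card_nbij' (fun p ↦ ⟨insert p.2 p.1, p.2⟩) (fun p ↦ ⟨p.1.erase p.2, p.2⟩)
      ?_ ?_ ?_ ?_
    · rintro ⟨S, y⟩ h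
      simp only [hD, hE, Finset.coe_sigma, Set.mem_sigma_iff, Finset.mem_coe, Finset.mem_filter,
        Finset.mem_univ, true_and] at h ⊢
      obtain ⟨⟨h1, h2, h3⟩, h4, h5⟩ := h
      exact ⟨⟨by rw [Finset.card_insert_of_notMem h4, h1], h5⟩, by simp,
        by rw [Finset.erase_insert h4, h3]⟩
    · rintro ⟨R, x⟩ h
      simp only [hD, hE, Finset.coe_sigma, Set.mem_sigma_iff, Finset.mem_coe, Finset.mem_filter,
        Finset.mem_univ, true_and] at h ⊢
      obtain ⟨⟨h1, h2⟩, h3, h4⟩ := h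
      exact ⟨⟨by rw [Finset.card_erase_add_one h3, h1], h2.mono (Finset.erase_subset _ _), h4⟩,
        by simp, by rwa [Finset.insert_erase h3]⟩
    · rintro ⟨S, y⟩ h
      simp only [Finset.coe_sigma, Set.mem_sigma_iff, Finset.mem_coe, Finset.mem_filter] at h
      simp [Finset.erase_insert h.2.2.1]
    · rintro ⟨R, x⟩ h
      simp only [Finset.coe_sigma, Set.mem_sigma_iff, Finset.mem_coe, Finset.mem_filter] at h
      simp [Finset.insert_erase h.2.1]
  have heven : Even (∑ R ∈ E, (R.filter fun x ↦
      (R.erase x).image c = Finset.univ.erase i₀).card) := by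
    refine Finset.even_sum _ fun R hR ↦ ?_
    obtain ⟨-, h1, h2⟩ := Finset.mem_filter.1 hR
    exact even_card_image_erase c i₀ h1 (hcon R h2)
  have hS₀ : (Finset.univ.erase i₀).image e ∈ D := by
    simp only [hD, Finset.mem_filter, Finset.mem_univ, true_and]
    refine ⟨?_, IsDominant.image_erase hea heb i₀, ?_⟩
    · rw [Finset.card_image_of_injective _ he, Finset.card_erase_add_one (Finset.mem_univ _),
        Finset.card_univ]
    · rw [Finset.image_image, show c ∘ e = id from funext hce, Finset.image_id]
  rw [← hcount, ← Finset.add_sum_erase _ _ hS₀,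
    IsDominant.card_insert_image_erase hr he hea heb i₀] at heven
  refine absurd heven (Nat.not_even_iff_odd.2 (Odd.add_even odd_one (Finset.even_sum _ ?_)))
  intro S hS
  obtain ⟨hne, hS⟩ := Finset.mem_erase.1 hS
  obtain ⟨-, h1, h2, h3⟩ := Finset.mem_filter.1 hS
  obtain ⟨x, hxS, hx⟩ : ∃ x ∈ S, x ∉ Set.range e := by
    by_contra! h
    refine hne (Finset.eq_of_subset_of_card_le (fun x hx ↦ ?_) ?_)
    · obtain ⟨m, rfl⟩ := h x hx
      have := Finset.mem_image_of_mem c hx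
      rw [h3, hce] at this
      exact Finset.mem_image_of_mem _ this
    · rw [Finset.card_image_of_injective _ he, ← h3]
      exact Finset.card_image_le
  rw [IsDominant.card_insert_eq_two hr h2 h1 heb hxS hx]
  exact even_two

end Scarf

section Brouwer

variable {I : Type*} [Fintype I]

/-- An integer vector with entries at least `-1` and too small a sum is strictly dominated by a
point of the grid of natural vectors of sum `N`. -/
theorem exists_mem_piAntidiag_gt [DecidableEq I] [Nonempty I] {N : ℕ} {m : I → ℤ}
    (hm : ∀ i, -1 ≤ m i) (hsum : ∑ i, (m i + 1) ≤ N) :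
    ∃ y ∈ Finset.piAntidiag (Finset.univ : Finset I) N, ∀ i, m i < y i := by
  obtain ⟨i₀⟩ : Nonempty I := inferInstance
  have hcast : ∀ i, ((m i + 1).toNat : ℤ) = m i + 1 := fun i ↦ Int.toNat_of_nonneg (by
    linarith [hm i])
  have hle : ∑ i, (m i + 1).toNat ≤ N := by
    zify
    simpa only [hcast] using hsum
  refine ⟨fun i ↦ (m i + 1).toNat + if i = i₀ then N - ∑ i, (m i + 1).toNat else 0, ?_,
    fun i ↦ ?_⟩
  · simp only [Finset.mem_piAntidiag, Finset.mem_univ, implies_true, and_true,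
      Finset.sum_add_distrib, Finset.sum_ite_eq', if_true]
    omega
  · push_cast [hcast]
    have : (0 : ℤ) ≤ if i = i₀ then ((N - ∑ i, (m i + 1).toNat : ℕ) : ℤ) else 0 := by
      split_ifs <;> positivity
    linarith

open Classical in
/-- For every colouring of the grid of natural vectors of sum `N`, there is a grid point each of
whose coordinates `i` is small unless a nearby grid point has colour `i`. -/
theorem exists_mem_piAntidiag_forall_le_or [Nontrivial I] (N : ℕ)
    (c : Finset.piAntidiag (Finset.univ : Finset I) N → I) :
    ∃ x : Finset.piAntidiag (Finset.univ : Finset I) N, ∀ i, x.1 i ≤ Fintype.card I ∨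
      ∃ w, c w = i ∧ ∀ j, |(x.1 j : ℤ) - w.1 j| ≤ Fintype.card I := by
  have hT : ∀ x : Finset.piAntidiag (Finset.univ : Finset I) N, ∑ i, x.1 i = N := fun x ↦
    (Finset.mem_piAntidiag.1 x.2).1
  let v : I → Finset.piAntidiag (Finset.univ : Finset I) N ⊕ I → ℤ := fun i ↦
    Sum.elim (fun x ↦ (x.1 i : ℤ)) fun j ↦ if i = j then -1 else N + 1
  let r : I → Finset.piAntidiag (Finset.univ : Finset I) N ⊕ I →
      ℤ ×ₗ Fin (Fintype.card (Finset.piAntidiag (Finset.univ : Finset I) N ⊕ I)) := fun i x ↦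
    toLex (v i x, Fintype.equivFin _ x)
  have hv : ∀ i x, -1 ≤ v i x := by
    rintro i (x | j)
    · simp only [v, Sum.elim_inl]; omega
    · simp only [v, Sum.elim_inr]; split_ifs <;> omega
  have hlt : ∀ i x y, v i x < v i y → r i x < r i y := fun i x y h ↦
    Prod.Lex.toLex_lt_toLex.2 (.inl h)
  have hle : ∀ i x y, r i x ≤ r i y → v i x ≤ v i y := fun i x y h ↦ by
    rcases Prod.Lex.toLex_le_toLex.1 h with h | h
    exacts [h.le, h.1.le]
  obtain ⟨R, hR, hcR⟩ := exists_isDominant_image_eq_univ (r := r) (e := Sum.inr)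
    (c := Sum.elim c id) (fun i x y h ↦ by
      simpa [r] using congrArg Prod.snd (toLex.injective h))
    (fun i x ↦ by
      by_cases hx : x = Sum.inr i
      · rw [hx]
      refine (hlt _ _ _ ?_).le
      rcases x with x | j
      · simp only [v, Sum.elim_inl, Sum.elim_inr, if_true]; omega
      · have : i ≠ j := fun h ↦ hx (by rw [h])
        simp only [v, Sum.elim_inr, if_true, if_neg this]; omega)
    (fun i j x hij hx ↦ by
      rcases x with x | k
      · apply hlt
        have : x.1 i ≤ ∑ i, x.1 i := Finset.single_le_sum (fun _ _ ↦ Nat.zero_le _)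
          (Finset.mem_univ i)
        rw [hT] at this
        simp only [v, Sum.elim_inl, Sum.elim_inr, if_neg hij]; omega
      · exact absurd ⟨k, rfl⟩ hx) (fun i ↦ rfl)
  have hRne : R.Nonempty := by
    rw [← Finset.image_nonempty (f := Sum.elim c id), hcR]
    exact Finset.univ_nonempty
  choose μ hμR hμ using fun i ↦ R.exists_min_image (v i) hRne
  have hsum : N < ∑ i, (v i (μ i) + 1) := by
    by_contra! h
    obtain ⟨y, hy, hlt'⟩ := exists_mem_piAntidiag_gt (fun i ↦ hv i (μ i)) h
    obtain ⟨i, hi⟩ := hR (Sum.inl ⟨y, hy⟩)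
    exact absurd (hle _ _ _ (hi _ (hμR i))) (not_le.2 (hlt' i))
  have hcol : ∀ i, Sum.inr i ∈ R ∨ ∃ w, Sum.inl w ∈ R ∧ c w = i := fun i ↦ by
    have : i ∈ R.image (Sum.elim c id) := by rw [hcR]; exact Finset.mem_univ _
    obtain ⟨x | j, hx, h⟩ := Finset.mem_image.1 this
    · exact .inr ⟨x, hx, h⟩
    · exact .inl (by rwa [← show j = i from h])
  obtain ⟨x, hx⟩ : ∃ x, Sum.inl x ∈ R := by
    by_contra! h
    have h' : ∀ i, v i (μ i) + 1 ≤ 0 := fun i ↦ by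
      rcases hcol i with hi | ⟨w, hw, -⟩
      · have := hμ i _ hi
        simp only [v, Sum.elim_inr, if_true] at this
        simp only [v]; omega
      · exact absurd hw (h w)
    have := Finset.sum_nonpos fun i (_ : i ∈ Finset.univ) ↦ h' i
    omega
  have hnear : ∀ w, Sum.inl w ∈ R → ∀ i,
      v i (μ i) ≤ w.1 i ∧ (w.1 i : ℤ) < v i (μ i) + Fintype.card I := fun w hw i ↦ by
    have h1 : ∀ i, v i (μ i) ≤ w.1 i := fun i ↦ hμ i _ hw
    refine ⟨h1 i, ?_⟩
    have h2 : (w.1 i : ℤ) - v i (μ i) ≤ ∑ i, ((w.1 i : ℤ) - v i (μ i)) :=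
      Finset.single_le_sum (f := fun i ↦ (w.1 i : ℤ) - v i (μ i))
        (fun i _ ↦ sub_nonneg.2 (h1 i)) (Finset.mem_univ i)
    rw [Finset.sum_sub_distrib, ← Nat.cast_sum, hT] at h2
    rw [Finset.sum_add_distrib, Finset.sum_const, Finset.card_univ, nsmul_one] at hsum
    linarith
  refine ⟨x, fun i ↦ (hcol i).imp (fun hi ↦ ?_) fun ⟨w, hw, hwi⟩ ↦ ⟨w, hwi, fun j ↦ ?_⟩⟩
  · have h1 := hμ i _ hi
    have h2 := (hnear x hx i).2
    simp only [v, Sum.elim_inr, if_true] at h1 h2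
    omega
  · have h1 := hnear x hx j
    have h2 := hnear w hw j
    rw [abs_le]
    constructor <;> linarith

/-- Approximate form of Brouwer's fixed point theorem on the standard simplex. -/
theorem exists_mem_stdSimplex_forall_le_or [Nontrivial I] {f : (I → ℝ) → I → ℝ}
    (hf : Set.MapsTo f (stdSimplex ℝ I) (stdSimplex ℝ I)) {ε : ℝ} (hε : 0 < ε) :
    ∃ x ∈ stdSimplex ℝ I, ∀ i, x i ≤ ε ∨ ∃ w ∈ stdSimplex ℝ I, dist w x ≤ ε ∧ w i ≤ f w i := by
  classical
  obtain ⟨N, hN⟩ := exists_nat_gt ((Fintype.card I : ℝ) / ε)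
  have hN0 : (0 : ℝ) < N := lt_of_le_of_lt (by positivity) hN
  have hNε : (Fintype.card I : ℝ) / N ≤ ε := by
    rw [div_lt_iff₀ hε] at hN
    rw [div_le_iff₀ hN0]
    linarith
  let p : Finset.piAntidiag (Finset.univ : Finset I) N → I → ℝ := fun a i ↦ a.1 i / N
  have hp : ∀ a, p a ∈ stdSimplex ℝ I := fun a ↦ by
    refine ⟨fun i ↦ by positivity, ?_⟩
    rw [← Finset.sum_div, ← Nat.cast_sum, (Finset.mem_piAntidiag.1 a.2).1, div_self hN0.ne']
  have hcol : ∀ a, ∃ i, p a i ≤ f (p a) i := fun a ↦ by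
    by_contra! h
    have := Finset.sum_lt_sum_of_nonempty (s := Finset.univ) Finset.univ_nonempty
      fun i _ ↦ h i
    rw [(hp a).2, (hf (hp a)).2] at this
    exact lt_irrefl _ this
  choose c hc using hcol
  obtain ⟨x, hx⟩ := exists_mem_piAntidiag_forall_le_or N c
  refine ⟨p x, hp x, fun i ↦ (hx i).imp (fun h ↦ ?_) ?_⟩
  · exact le_trans (by simp only [p]; gcongr) hNε
  · rintro ⟨w, rfl, hw⟩
    refine ⟨p w, hp w, (dist_pi_le_iff hε.le).2 fun j ↦ ?_, hc w⟩
    have h : |(x.1 j : ℝ) - w.1 j| ≤ Fintype.card I := by exact_mod_cast hw j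
    rw [dist_comm, Real.dist_eq]
    simp only [p]
    rw [← sub_div, abs_div, abs_of_pos hN0]
    exact le_trans (by gcongr) hNε

/-- **Brouwer's fixed point theorem** for the standard simplex. -/
theorem exists_isFixedPt_stdSimplex [Nonempty I] {f : (I → ℝ) → I → ℝ}
    (hfc : ContinuousOn f (stdSimplex ℝ I))
    (hf : Set.MapsTo f (stdSimplex ℝ I) (stdSimplex ℝ I)) :
    ∃ x ∈ stdSimplex ℝ I, f x = x := by
  classical
  rcases subsingleton_or_nontrivial I with hI | hI
  · obtain ⟨i⟩ : Nonempty I := inferInstance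
    have hx := single_mem_stdSimplex ℝ i
    refine ⟨_, hx, funext fun j ↦ ?_⟩
    have h1 := (hf hx).2
    have h2 := hx.2
    rw [Fintype.sum_subsingleton _ j] at h1 h2
    rw [h1, h2]
  choose x hxΔ hx using fun n : ℕ ↦
    exists_mem_stdSimplex_forall_le_or hf (Nat.one_div_pos_of_nat (α := ℝ) (n := n))
  obtain ⟨z, hz, φ, hφ, hlim⟩ := (isCompact_stdSimplex ℝ I).tendsto_subseq hxΔ
  have hε := (tendsto_one_div_add_atTop_nhds_zero_nat (𝕜 := ℝ)).comp hφ.tendsto_atTop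
  have hle : ∀ i, z i ≤ f z i := fun i ↦ by
    by_contra! hlt
    have hzi : 0 < z i := ((hf hz).1 i).trans_lt hlt
    have hopen : ∀ᶠ w in nhdsWithin z (stdSimplex ℝ I), f w i < w i :=
      ((continuous_apply i).continuousAt.comp_continuousWithinAt (hfc z hz)).eventually_lt
        (continuous_apply i).continuousWithinAt hlt
    obtain ⟨δ, hδ, hball⟩ := Metric.mem_nhdsWithin_iff.1 hopen
    have h1 : ∀ᶠ n in Filter.atTop, dist (x (φ n)) z < δ / 2 :=
      (Metric.tendsto_nhds.1 hlim) _ (half_pos hδ)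
    have h2 : ∀ᶠ n in Filter.atTop, 1 / ((φ n : ℝ) + 1) < δ / 2 :=
      hε.eventually_lt_const (half_pos hδ)
    have h3 : ∀ᶠ n in Filter.atTop, 1 / ((φ n : ℝ) + 1) < x (φ n) i :=
      hε.eventually_lt (((continuous_apply i).tendsto z).comp hlim) hzi
    obtain ⟨n, h1, h2, h3⟩ := (h1.and (h2.and h3)).exists
    rcases hx (φ n) i with h | ⟨w, hw, hd, hwi⟩
    · exact absurd h (not_le.2 h3)
    · have : f w i < w i := hball ⟨by
        rw [Metric.mem_ball]
        linarith [dist_triangle w (x (φ n)) z], hw⟩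
      exact absurd hwi (not_le.2 this)
  refine ⟨z, hz, funext fun i ↦ ?_⟩
  exact (((Finset.sum_eq_sum_iff_of_le fun i _ ↦ hle i).1
    (by rw [hz.2, (hf hz).2])) i (Finset.mem_univ i)).symm

end Brouwer

section Schauder

variable {X : Type*} [NormedAddCommGroup X] [NormedSpace ℝ X]

/-- Approximate form of Schauder's fixed point theorem. -/
theorem exists_norm_sub_le_of_isCompact {B K : Set X} (hB : Convex ℝ B) (hne : B.Nonempty)
    {F : X → X} (hFc : ContinuousOn F B) (hK : IsCompact K) (hKB : K ⊆ B)
    (hF : Set.MapsTo F B K) {ε : ℝ} (hε : 0 < ε) : ∃ x ∈ B, ‖x - F x‖ ≤ ε := by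
  obtain ⟨t, htK, hcov⟩ := hK.elim_finite_subcover_image (b := K) (c := fun y ↦ Metric.ball y ε)
    (fun _ _ ↦ Metric.isOpen_ball) fun y hy ↦ Set.mem_biUnion hy (Metric.mem_ball_self hε)
  obtain ⟨htfin, hcov⟩ := hcov
  have : Fintype t := htfin.fintype
  let φ : t → X → ℝ := fun y z ↦ max 0 (ε - dist z y)
  have hφc : ∀ y, Continuous (φ y) := fun y ↦ by fun_prop
  have hφ0 : ∀ y z, 0 ≤ φ y z := fun y z ↦ le_max_left _ _
  have hpos : ∀ z ∈ K, 0 < ∑ y, φ y z := fun z hz ↦ by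
    obtain ⟨y, hy, hzy⟩ := Set.mem_iUnion₂.1 (hcov hz)
    exact Finset.sum_pos' (fun y _ ↦ hφ0 y z)
      ⟨⟨y, hy⟩, Finset.mem_univ _, lt_max_of_lt_right (sub_pos.2 hzy)⟩
  let comb : (t → ℝ) → X := fun a ↦ ∑ y, a y • (y : X)
  have hcomb : ∀ a ∈ stdSimplex ℝ t, comb a ∈ B := fun a ha ↦
    hB.sum_mem (fun y _ ↦ ha.1 y) ha.2 fun y _ ↦ hKB (htK y.2)
  have hcombc : Continuous comb := by fun_prop
  have hFcomb : ContinuousOn (fun a ↦ F (comb a)) (stdSimplex ℝ t) :=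
    hFc.comp hcombc.continuousOn hcomb
  have : Nonempty t := by
    obtain ⟨b, hb⟩ := hne
    obtain ⟨y, hy, -⟩ := Set.mem_iUnion₂.1 (hcov (hF hb))
    exact ⟨⟨y, hy⟩⟩
  obtain ⟨a, ha, hfix⟩ := exists_isFixedPt_stdSimplex
    (f := fun a y ↦ φ y (F (comb a)) / ∑ y, φ y (F (comb a)))
    (continuousOn_pi.2 fun y ↦ ((hφc y).comp_continuousOn hFcomb).div
      (continuousOn_finsetSum _ fun y _ ↦ (hφc y).comp_continuousOn hFcomb)
      fun a ha ↦ (hpos _ (hF (hcomb a ha))).ne')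
    (fun a ha ↦ by
      have := hpos _ (hF (hcomb a ha))
      refine ⟨fun y ↦ div_nonneg (hφ0 _ _) this.le, ?_⟩
      rw [← Finset.sum_div, div_self this.ne'])
  refine ⟨comb a, hcomb a ha, ?_⟩
  have hsub : comb a - F (comb a) = ∑ y, a y • ((y : X) - F (comb a)) := by
    simp only [smul_sub, Finset.sum_sub_distrib, ← Finset.sum_smul, ha.2, one_smul, comb]
  calc ‖comb a - F (comb a)‖ ≤ ∑ y, ‖a y • ((y : X) - F (comb a))‖ := by
        rw [hsub]; exact norm_sum_le _ _
    _ ≤ ∑ y, a y * ε := Finset.sum_le_sum fun y _ ↦ by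
        rw [norm_smul, Real.norm_of_nonneg (ha.1 y)]
        by_cases h : dist (F (comb a)) y < ε
        · rw [dist_comm, dist_eq_norm] at h
          exact mul_le_mul_of_nonneg_left h.le (ha.1 y)
        · have h0 : φ y (F (comb a)) = 0 := max_eq_left (by linarith)
          have : a y = 0 := by rw [← congrFun hfix y, h0, zero_div]
          simp [this]
    _ = ε := by rw [← Finset.sum_mul, ha.2, one_mul]

/-- **Schauder's fixed point theorem**. -/
theorem exists_isFixedPt_of_isCompact {B K : Set X} (hB : Convex ℝ B) (hBc : IsClosed B)
    (hne : B.Nonempty) {F : X → X} (hFc : ContinuousOn F B) (hK : IsCompact K)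
    (hFB : Set.MapsTo F B B) (hFK : Set.MapsTo F B K) : ∃ x ∈ B, F x = x := by
  choose x hxB hx using fun n : ℕ ↦ exists_norm_sub_le_of_isCompact hB hne hFc
    (hK.inter_right hBc) Set.inter_subset_right (fun x hx ↦ ⟨hFK hx, hFB hx⟩)
    (Nat.one_div_pos_of_nat (α := ℝ) (n := n))
  obtain ⟨z, hz, φ, hφ, hlim⟩ :=
    (hK.inter_right hBc).tendsto_subseq fun n ↦ (⟨hFK (hxB n), hFB (hxB n)⟩ : F (x n) ∈ K ∩ B)
  have hdiff : Filter.Tendsto (fun n ↦ x (φ n) - F (x (φ n))) Filter.atTop (nhds 0) :=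
    squeeze_zero_norm (fun n ↦ hx (φ n))
      ((tendsto_one_div_add_atTop_nhds_zero_nat (𝕜 := ℝ)).comp hφ.tendsto_atTop)
  have hxz : Filter.Tendsto (fun n ↦ x (φ n)) Filter.atTop (nhds z) := by
    simpa using hdiff.add hlim
  refine ⟨z, hz.2, tendsto_nhds_unique ?_ hlim⟩
  exact (hFc z hz.2).tendsto.comp
    (tendsto_nhdsWithin_iff.2 ⟨hxz, Filter.Eventually.of_forall fun n ↦ hxB (φ n)⟩)

end Schauder

/-- **Schauder fixed point theorem, quantitative form.**
Let `X` be a real Banach space, `L : X → X` a bounded linear operator and `Q : X → X` a map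
with `‖Q x‖ ≤ q ‖x‖ ^ 2` whenever `‖x‖ ≤ s₀`.  If `L` and `Q` are completely continuous
(continuous and mapping bounded sets to relatively compact sets) and
`‖x₀‖ + ‖L‖ * s + q * s ^ 2 ≤ s` for some `0 < s ≤ s₀`, then `x = x₀ + L x + Q x` has a
solution `x✶` with `‖x✶‖ ≤ s`. -/
theorem schauder_quadratic_fixed_point
    {X : Type*} [NormedAddCommGroup X] [NormedSpace ℝ X] [CompleteSpace X]
    (L : X →L[ℝ] X) (Q : X → X) (q s₀ : ℝ) (hq : 0 ≤ q) (hs₀ : 0 < s₀)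
    (hQbound : ∀ x : X, ‖x‖ ≤ s₀ → ‖Q x‖ ≤ q * ‖x‖ ^ 2)
    (hLcompact : ∀ S : Set X, Bornology.IsBounded S → IsCompact (closure (L '' S)))
    (hQcont : Continuous Q)
    (hQcompact : ∀ S : Set X, Bornology.IsBounded S → IsCompact (closure (Q '' S)))
    (x₀ : X) (s : ℝ) (hs : 0 < s) (hss₀ : s ≤ s₀)
    (hineq : ‖x₀‖ + ‖L‖ * s + q * s ^ 2 ≤ s) :
    ∃ x : X, x = x₀ + L x + Q x ∧ ‖x‖ ≤ s := by
  have hcl : ∀ G : X → X, ∀ x ∈ Metric.closedBall (0 : X) s,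
      G x ∈ closure (G '' Metric.closedBall 0 s) := fun G x hx ↦
    subset_closure (Set.mem_image_of_mem G hx)
  obtain ⟨x, hx, hfix⟩ := exists_isFixedPt_of_isCompact (F := fun x ↦ x₀ + L x + Q x)
    (convex_closedBall (0 : X) s) Metric.isClosed_closedBall (Metric.nonempty_closedBall.2 hs.le)
    (by fun_prop)
    ((isCompact_singleton (x := x₀)).add (hLcompact _ Metric.isBounded_closedBall) |>.add
      (hQcompact _ Metric.isBounded_closedBall))
    (fun x hx ↦ by
      rw [mem_closedBall_zero_iff] at hx ⊢
      calc ‖x₀ + L x + Q x‖ ≤ ‖x₀‖ + ‖L x‖ + ‖Q x‖ := norm_add₃_le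
        _ ≤ ‖x₀‖ + ‖L‖ * s + q * s ^ 2 := by
          gcongr
          · exact L.le_opNorm_of_le hx
          · exact (hQbound x (hx.trans hss₀)).trans (by gcongr)
        _ ≤ s := hineq)
    (fun x hx ↦ Set.add_mem_add (Set.add_mem_add rfl (hcl L x hx)) (hcl Q x hx))
  exact ⟨x, hfix.symm, mem_closedBall_zero_iff.1 hx⟩
end

section
/- Let d₁, d₂ ≥ 2 be integers, set λ = d₁ + d₂, and let α > 0. Then there exist a unique t_α > 0 and a unique pair of smooth functions f₁, f₂ : (−t_α, t_α] → ℝ such that: f₁ is even and f₂ is odd on (−t_α, t_α); f₁ > 0 on [0, t_α] and f₂ > 0 on (0, t_α]; f₁(0) = √(d₁−1)/α and f₂'(0) = 1; f₁, f₂ satisfy all three equations of the Einstein ODE system on (0, t_α]; and the quantity Z(t) = d₁f₁'(t)/f₁(t) + d₂f₂'(t)/f₂(t) is strictly positive for t ∈ (0, t_α) and satisfies Z(t_α) = 0. -/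
noncomputable section

/-- Derivative within the half-open interval `(−tα, tα]`. -/
def dIoc (tα : ℝ) (f : ℝ → ℝ) : ℝ → ℝ :=
  derivWithin f (Set.Ioc (-tα) tα)

/-- The mean-curvature quantity `Z(t) = d₁ f₁'(t)/f₁(t) + d₂ f₂'(t)/f₂(t)`,
with derivatives taken within `(−tα, tα]`. -/
def Zfun (d₁ d₂ : ℕ) (tα : ℝ) (f₁ f₂ : ℝ → ℝ) (t : ℝ) : ℝ :=
  (d₁ : ℝ) * dIoc tα f₁ t / f₁ t + (d₂ : ℝ) * dIoc tα f₂ t / f₂ t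

/-- The solution property for the singular initial value problem of Proposition `IVPf`
(with `λ = d₁ + d₂`): `f₁, f₂` are smooth on `(−tα, tα]`, `f₁` even and `f₂` odd on
`(−tα, tα)`, positive as required, satisfy the initial conditions
`f₁(0) = √(d₁−1)/α`, `f₂'(0) = 1`, all three Einstein ODEs on `(0, tα]`, and the stopping
condition: `Z > 0` on `(0, tα)` and `Z(tα) = 0`. -/
def EinsteinIVPSol (d₁ d₂ : ℕ) (α tα : ℝ) (f₁ f₂ : ℝ → ℝ) : Prop :=
  ContDiffOn ℝ (⊤ : ℕ∞) f₁ (Set.Ioc (-tα) tα) ∧ ContDiffOn ℝ (⊤ : ℕ∞) f₂ (Set.Ioc (-tα) tα) ∧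
  (∀ t ∈ Set.Ioo (-tα) tα, f₁ (-t) = f₁ t) ∧
  (∀ t ∈ Set.Ioo (-tα) tα, f₂ (-t) = -f₂ t) ∧
  (∀ t ∈ Set.Icc 0 tα, 0 < f₁ t) ∧ (∀ t ∈ Set.Ioc 0 tα, 0 < f₂ t) ∧
  f₁ 0 = Real.sqrt ((d₁ : ℝ) - 1) / α ∧
  dIoc tα f₂ 0 = 1 ∧
  (∀ t ∈ Set.Ioc 0 tα,
    (d₁ : ℝ) * dIoc tα (dIoc tα f₁) t / f₁ t
      + (d₂ : ℝ) * dIoc tα (dIoc tα f₂) t / f₂ t = -((d₁ : ℝ) + (d₂ : ℝ)) ∧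
    dIoc tα (dIoc tα f₁) t / f₁ t + ((d₁ : ℝ) - 1) * (dIoc tα f₁ t) ^ 2 / (f₁ t) ^ 2
      + (d₂ : ℝ) * (dIoc tα f₁ t * dIoc tα f₂ t) / (f₁ t * f₂ t)
      - ((d₁ : ℝ) - 1) / (f₁ t) ^ 2 = -((d₁ : ℝ) + (d₂ : ℝ)) ∧
    dIoc tα (dIoc tα f₂) t / f₂ t + ((d₂ : ℝ) - 1) * (dIoc tα f₂ t) ^ 2 / (f₂ t) ^ 2
      + (d₁ : ℝ) * (dIoc tα f₁ t * dIoc tα f₂ t) / (f₁ t * f₂ t)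
      - ((d₂ : ℝ) - 1) / (f₂ t) ^ 2 = -((d₁ : ℝ) + (d₂ : ℝ))) ∧
  (∀ t ∈ Set.Ioo 0 tα, 0 < Zfun d₁ d₂ tα f₁ f₂ t) ∧
  Zfun d₁ d₂ tα f₁ f₂ tα = 0

section EinsteinSystem

open Set Filter Topology
open scoped ContDiff

theorem summable_norm_mul_pow_of_geometric_bound {a : ℕ → ℝ} {M R : ℝ} (hR : 0 < R)
    (ha : ∀ j, |a j| ≤ M * R ^ j) {s : ℝ} (hs : |s| * R < 1) :
    Summable fun j => ‖a j * s ^ j‖ := by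
  refine Summable.of_nonneg_of_le (fun j => norm_nonneg _) (fun j => ?_)
    ((summable_geometric_of_lt_one (mul_nonneg (abs_nonneg s) hR.le) hs).mul_left M)
  rw [norm_mul, norm_pow, Real.norm_eq_abs, Real.norm_eq_abs, mul_pow, mul_left_comm, mul_comm]
  exact mul_le_mul_of_nonneg_left (ha j) (by positivity)

theorem contDiffOn_tsum_mul_pow {a : ℕ → ℝ} {M R : ℝ} (hR : 0 < R)
    (ha : ∀ j, |a j| ≤ M * R ^ j) :
    ContDiffOn ℝ ∞ (fun s => ∑' j, a j * s ^ j) (Metric.ball 0 R⁻¹) := by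
  set p := FormalMultilinearSeries.ofScalars ℝ a with hp
  have hrad : ENNReal.ofReal R⁻¹ ≤ p.radius := by
    refine p.le_radius_of_bound (r := R⁻¹.toNNReal) M fun n => ?_
    rw [hp, FormalMultilinearSeries.ofScalars_norm, Real.coe_toNNReal _ (by positivity), inv_pow,
      ← div_eq_mul_inv, div_le_iff₀ (by positivity)]
    exact ha n
  have hpos : 0 < p.radius := lt_of_lt_of_le (by simpa using hR) hrad
  have h := p.hasFPowerSeriesOnBall hpos
  have h2 := h.analyticOnNhd.contDiffOn (n := ∞) (Metric.isOpen_eball.uniqueDiffOn)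
  have h3 : p.sum = fun s => ∑' j, a j * s ^ j := by
    funext s
    simp [hp, FormalMultilinearSeries.sum, mul_comm]
  rw [h3] at h2
  refine h2.mono ?_
  rw [← Metric.eball_ofReal]
  exact Metric.eball_subset_eball hrad

theorem hasDerivAt_tsum_mul_pow {a : ℕ → ℝ} {M R : ℝ} (hR : 0 < R)
    (ha : ∀ j, |a j| ≤ M * R ^ j) {s : ℝ} (hs : |s| * R < 1) :
    Summable (fun j : ℕ => ((j : ℝ) + 1) * a (j + 1) * s ^ j) ∧
    HasDerivAt (fun s => ∑' j, a j * s ^ j)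
      (∑' j : ℕ, ((j : ℝ) + 1) * a (j + 1) * s ^ j) s := by
  obtain ⟨r, hr1, hr2⟩ := exists_between (show |s| < R⁻¹ by
    rwa [← one_div, lt_div_iff₀ hR])
  have hr0 : 0 < r := lt_of_le_of_lt (abs_nonneg s) hr1
  have hrR : r * R < 1 := by rwa [← one_div, lt_div_iff₀ hR] at hr2
  have hb : ∀ (n : ℕ) (y : ℝ), |y| < r →
      ‖a n * (n * y ^ (n - 1))‖ ≤ M * r⁻¹ * ((n : ℝ) ^ 1 * (r * R) ^ n) := by
    intro n y hy
    rcases n with _ | n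
    · simp
    · rw [norm_mul, norm_mul, norm_pow, Real.norm_eq_abs, Real.norm_eq_abs, Real.norm_eq_abs,
        Nat.abs_cast, Nat.add_sub_cancel]
      calc |a (n + 1)| * (((n + 1 : ℕ) : ℝ) * |y| ^ n)
          ≤ (M * R ^ (n + 1)) * (((n + 1 : ℕ) : ℝ) * r ^ n) := by
            have := (abs_nonneg _).trans (ha (n + 1))
            gcongr
            exact ha (n + 1)
        _ = M * r⁻¹ * (((n + 1 : ℕ) : ℝ) ^ 1 * (r * R) ^ (n + 1)) := by
            rw [mul_pow r, pow_succ r, pow_one]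
            generalize ((n + 1 : ℕ) : ℝ) = k
            field_simp
  have hn : ‖r * R‖ < 1 := by rwa [Real.norm_eq_abs, abs_of_pos (mul_pos hr0 hR)]
  have hu : Summable fun n : ℕ => M * r⁻¹ * ((n : ℝ) ^ 1 * (r * R) ^ n) :=
    (summable_pow_mul_geometric_of_norm_lt_one (R := ℝ) 1 hn).mul_left _
  have h0 : Summable fun n : ℕ => a n * (0 : ℝ) ^ n :=
    summable_of_ne_finset_zero (s := {0}) (by intro n hn; simp at hn; simp [hn])
  have hd := hasDerivAt_tsum_of_isPreconnected (g := fun n y => a n * y ^ n)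
    (g' := fun n y => a n * (n * y ^ (n - 1))) (t := Ioo (-r) r) (y₀ := 0) (y := s) hu isOpen_Ioo
    isPreconnected_Ioo (fun n y _ => (hasDerivAt_pow n y).const_mul (a n))
    (fun n y hy => hb n y (abs_lt.2 hy)) (by constructor <;> linarith)
    h0
    (abs_lt.1 hr1)
  have hs' : Summable fun n : ℕ => a n * (n * s ^ (n - 1)) :=
    Summable.of_norm_bounded hu fun n => hb n s hr1
  have he : ∀ n : ℕ, a (n + 1) * (((n + 1 : ℕ) : ℝ) * s ^ (n + 1 - 1)) =
      ((n : ℝ) + 1) * a (n + 1) * s ^ n := by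
    intro n
    push_cast
    ring
  refine ⟨((summable_nat_add_iff 1).2 hs').congr he, ?_⟩
  have ht : ∑' n : ℕ, a n * (n * s ^ (n - 1)) = ∑' n : ℕ, ((n : ℝ) + 1) * a (n + 1) * s ^ n := by
    rw [hs'.tsum_eq_zero_add, tsum_congr he, Nat.cast_zero, zero_mul, mul_zero, zero_add]
  exact ht ▸ hd

theorem tsum_mul_pow_mul_tsum_mul_pow {a b : ℕ → ℝ} {M R : ℝ} (hR : 0 < R)
    (ha : ∀ j, |a j| ≤ M * R ^ j) (hb : ∀ j, |b j| ≤ M * R ^ j) {s : ℝ} (hs : |s| * R < 1) :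
    HasSum (fun j : ℕ => (∑ i : Fin (j + 1), a i * b (j - i)) * s ^ j)
      ((∑' j, a j * s ^ j) * ∑' j, b j * s ^ j) := by
  have h1 := summable_norm_mul_pow_of_geometric_bound hR ha hs
  have h2 := summable_norm_mul_pow_of_geometric_bound hR hb hs
  rw [tsum_mul_tsum_eq_tsum_sum_range_of_summable_norm h1 h2]
  have h3 := summable_norm_sum_mul_range_of_summable_norm h1 h2
  have h4 : ∀ j : ℕ, ∑ k ∈ Finset.range (j + 1), a k * s ^ k * (b (j - k) * s ^ (j - k)) =
      (∑ i : Fin (j + 1), a i * b (j - i)) * s ^ j := by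
    intro j
    rw [Fin.sum_univ_eq_sum_range (fun i => a i * b (j - i)), Finset.sum_mul]
    refine Finset.sum_congr rfl fun k hk => ?_
    have : k ≤ j := by simpa [Nat.lt_succ_iff] using hk
    rw [← pow_sub_mul_pow s this]
    ring
  simpa only [h4] using h3.of_norm.hasSum

theorem catalan_le_four_pow (n : ℕ) : catalan n ≤ 4 ^ n := by
  rw [catalan_eq_centralBinom_div]
  exact (Nat.div_le_self _ _).trans (Nat.centralBinom_le_four_pow n)

/-- A sequence defined by a convolution-type recursion. -/
def convRec {V : Type*} [AddCommMonoid V] (v : V) (Q : ℕ → V → V → V) : ℕ → V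
  | 0 => v
  | j + 1 => ∑ i : Fin (j + 1), Q j (convRec v Q i) (convRec v Q (j - i))

theorem norm_convRec_le {V : Type*} [SeminormedAddCommGroup V] (v : V) (Q : ℕ → V → V → V) {K : ℝ}
    (hK : 0 ≤ K) (hQ : ∀ j u w, ‖Q j u w‖ ≤ K * ‖u‖ * ‖w‖) (j : ℕ) :
    ‖convRec v Q j‖ ≤ ‖v‖ * (K * ‖v‖) ^ j * catalan j := by
  induction j using Nat.strong_induction_on with
  | _ j ih =>
    rcases j with _ | j
    · simp [convRec]
    · rw [convRec, catalan_succ]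
      refine (norm_sum_le _ _).trans ?_
      push_cast
      rw [Finset.mul_sum]
      refine Finset.sum_le_sum fun i _ => (hQ _ _ _).trans ?_
      have h1 := ih i i.2
      have h2 := ih (j - i) (by omega)
      calc K * ‖convRec v Q i‖ * ‖convRec v Q (j - i)‖
          ≤ K * (‖v‖ * (K * ‖v‖) ^ (i : ℕ) * catalan i) *
            (‖v‖ * (K * ‖v‖) ^ (j - (i : ℕ)) * catalan (j - i)) := by gcongr
        _ = K * ‖v‖ * ‖v‖ * ((K * ‖v‖) ^ (j - (i : ℕ)) * (K * ‖v‖) ^ (i : ℕ)) *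
            (catalan i * catalan (j - i)) := by ring
        _ = _ := by
          rw [pow_sub_mul_pow _ (Nat.lt_succ_iff.1 i.2)]
          simp only [Nat.succ_eq_add_one]
          ring

theorem norm_convRec_le_geometric {V : Type*} [SeminormedAddCommGroup V] (v : V)
    (Q : ℕ → V → V → V) {K : ℝ} (hK : 0 ≤ K) (hQ : ∀ j u w, ‖Q j u w‖ ≤ K * ‖u‖ * ‖w‖) (j : ℕ) :
    ‖convRec v Q j‖ ≤ ‖v‖ * (4 * (K * ‖v‖) + 1) ^ j := by
  refine (norm_convRec_le v Q hK hQ j).trans ?_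
  have h : (catalan j : ℝ) ≤ 4 ^ j := by exact_mod_cast catalan_le_four_pow j
  calc ‖v‖ * (K * ‖v‖) ^ j * catalan j ≤ ‖v‖ * (K * ‖v‖) ^ j * 4 ^ j := by gcongr
    _ = ‖v‖ * (4 * (K * ‖v‖)) ^ j := by rw [mul_pow 4]; ring
    _ ≤ _ := by gcongr; linarith

theorem tsum_mul_pow_eq_zero_add {a : ℕ → ℝ} {M R : ℝ} (hR : 0 < R)
    (ha : ∀ j, |a j| ≤ M * R ^ j) {s : ℝ} (hs : |s| * R < 1) :
    Summable (fun j => a (j + 1) * s ^ j) ∧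
      ∑' j, a j * s ^ j = a 0 + s * ∑' j, a (j + 1) * s ^ j := by
  have h1 : ∀ j, |a (j + 1)| ≤ M * R * R ^ j := fun j =>
    (ha (j + 1)).trans_eq (by rw [pow_succ']; ring)
  refine ⟨(summable_norm_mul_pow_of_geometric_bound hR h1 hs).of_norm, ?_⟩
  rw [(summable_norm_mul_pow_of_geometric_bound hR ha hs).of_norm.tsum_eq_zero_add,
    ← tsum_mul_left, pow_zero, mul_one]
  congr 1
  refine tsum_congr fun j => ?_
  rw [pow_succ']
  ring

/-- The quadratic form of the recursion for the Taylor coefficients, in the variable `s = t ^ 2`,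
of the Einstein system desingularized at the collapsing orbit. -/
def einsteinQuad (p q : ℝ) (j : ℕ) (u w : ℝ × ℝ × ℝ) : ℝ × ℝ × ℝ :=
  (-(u.2.1 * w.1) / (j + 1),
    (-(u.2.1 * w.1) / (j + 1) - u.2.2 * w.2.1) / (2 * j + 3 + q),
    (2 * p * ((-(u.2.1 * w.1) / (j + 1) - u.2.2 * w.2.1) / (2 * j + 3 + q)) -
      p * (u.2.1 * w.2.1) - (u.2.2 - p * u.2.1) * (w.2.2 - p * w.2.1) / q) / (2 * j + 5))

theorem abs_div_le_of_one_le {x y B : ℝ} (hy : 1 ≤ y) (hx : |x| ≤ B) : |x / y| ≤ B := by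
  rw [abs_div, abs_of_nonneg (zero_le_one.trans hy)]
  exact (div_le_self (abs_nonneg _) hy).trans hx

theorem norm_einsteinQuad_le {p q : ℝ} (hp : 0 ≤ p) (hq : 1 ≤ q) (j : ℕ) (u w : ℝ × ℝ × ℝ) :
    ‖einsteinQuad p q j u w‖ ≤ (5 * p + (1 + p) ^ 2 + 2) * ‖u‖ * ‖w‖ := by
  obtain ⟨x, a, c⟩ := u
  obtain ⟨y, b, d⟩ := w
  set U := ‖(x, a, c)‖ with hU
  set W := ‖(y, b, d)‖ with hW
  have hU0 : 0 ≤ U := norm_nonneg _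
  have hW0 : 0 ≤ W := norm_nonneg _
  have ha : |a| ≤ U := (norm_fst_le (a, c)).trans (norm_snd_le (x, a, c))
  have hc : |c| ≤ U := (norm_snd_le (a, c)).trans (norm_snd_le (x, a, c))
  have hy : |y| ≤ W := norm_fst_le (y, b, d)
  have hb : |b| ≤ W := (norm_fst_le (b, d)).trans (norm_snd_le (y, b, d))
  have hd : |d| ≤ W := (norm_snd_le (b, d)).trans (norm_snd_le (y, b, d))
  have hj : (0 : ℝ) ≤ j := Nat.cast_nonneg j
  have hUW : 0 ≤ U * W := mul_nonneg hU0 hW0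
  have h1 : |-(a * y) / ((j : ℝ) + 1)| ≤ U * W :=
    abs_div_le_of_one_le (by linarith) (by rw [abs_neg, abs_mul]; gcongr)
  have h2 : |(-(a * y) / ((j : ℝ) + 1) - c * b) / (2 * j + 3 + q)| ≤ 2 * (U * W) := by
    refine abs_div_le_of_one_le (by linarith) ((abs_sub _ _).trans ?_)
    have : |c * b| ≤ U * W := by rw [abs_mul]; gcongr
    linarith
  have h3 : |p * (a * b)| ≤ p * (U * W) := by
    rw [abs_mul, abs_mul, abs_of_nonneg hp]; gcongr
  have h4 : |c - p * a| ≤ (1 + p) * U := by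
    refine (abs_sub _ _).trans ?_
    rw [abs_mul, abs_of_nonneg hp]
    nlinarith
  have h5 : |d - p * b| ≤ (1 + p) * W := by
    refine (abs_sub _ _).trans ?_
    rw [abs_mul, abs_of_nonneg hp]
    nlinarith
  have h6 : |(c - p * a) * (d - p * b) / q| ≤ (1 + p) ^ 2 * (U * W) := by
    refine abs_div_le_of_one_le hq ?_
    rw [abs_mul]
    calc _ ≤ ((1 + p) * U) * ((1 + p) * W) := by gcongr
      _ = _ := by ring
  have h7 : |2 * p * ((-(a * y) / ((j : ℝ) + 1) - c * b) / (2 * j + 3 + q))| ≤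
      2 * p * (2 * (U * W)) := by
    rw [abs_mul, abs_of_nonneg (by positivity : 0 ≤ 2 * p)]; gcongr
  have hpUW : 0 ≤ p * (U * W) := by positivity
  have hpUW' : 0 ≤ (1 + p) ^ 2 * (U * W) := by positivity
  have e : (5 * p + (1 + p) ^ 2 + 2) * U * W =
      5 * (p * (U * W)) + (1 + p) ^ 2 * (U * W) + 2 * (U * W) := by ring
  rw [e, einsteinQuad, Prod.norm_def, Prod.norm_def]
  refine max_le ?_ (max_le ?_ ?_)
  · exact h1.trans (by linarith)
  · exact h2.trans (by linarith)
  · refine abs_div_le_of_one_le (by linarith) ((abs_sub _ _).trans ?_)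
    refine (add_le_add_left (abs_sub _ _) _).trans ?_
    linarith

theorem exists_powerSeries_solution {p q : ℝ} (hp : 0 ≤ p) (hq : 1 ≤ q) (x₀ : ℝ) :
    ∃ r : ℝ, 0 < r ∧ ∃ X P C : ℝ → ℝ, ContDiffOn ℝ ∞ X (Ioo (-r) r) ∧
      ContDiffOn ℝ ∞ P (Ioo (-r) r) ∧ ContDiffOn ℝ ∞ C (Ioo (-r) r) ∧ X 0 = x₀ ∧
      ∀ s ∈ Ioo (-r) r, ∃ X' P' C', HasDerivAt X X' s ∧ HasDerivAt P P' s ∧ HasDerivAt C C' s ∧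
        X' = -(P s * X s) ∧
        2 * s * P' = -(q + 1) * P s - (p + q) + X s - s * (C s * P s) ∧
        2 * s * C' = -3 * C s + 2 * p * P s - (p + q) -
          s * (p * (P s * P s) + (C s - p * P s) * (C s - p * P s) / q) := by
  set P₀ := (x₀ - (p + q)) / (q + 1) with hP₀
  set C₀ := (2 * p * P₀ - (p + q)) / 3 with hC₀
  set w := convRec (x₀, P₀, C₀) (einsteinQuad p q) with hw
  set K := 5 * p + (1 + p) ^ 2 + 2 with hK
  have hK0 : 0 ≤ K := by positivity
  set N := ‖(x₀, P₀, C₀)‖ with hN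
  have hN0 : 0 ≤ N := norm_nonneg _
  set R := 4 * (K * N) + 1 with hR
  have hR0 : 0 < R := by positivity
  have hbound : ∀ j, ‖w j‖ ≤ N * R ^ j :=
    norm_convRec_le_geometric _ _ hK0 (norm_einsteinQuad_le hp hq)
  set M := (1 + p) * N with hM
  have hNM : N ≤ M := by nlinarith
  have hle : ∀ j, N * R ^ j ≤ M * R ^ j := fun j => by gcongr
  set x : ℕ → ℝ := fun j => (w j).1 with hx
  set a : ℕ → ℝ := fun j => (w j).2.1 with ha
  set c : ℕ → ℝ := fun j => (w j).2.2 with hc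
  set d : ℕ → ℝ := fun j => c j - p * a j with hd
  have hxb' : ∀ j, |x j| ≤ N * R ^ j := fun j => (norm_fst_le _).trans (hbound j)
  have hab' : ∀ j, |a j| ≤ N * R ^ j := fun j =>
    ((norm_fst_le _).trans (norm_snd_le _)).trans (hbound j)
  have hcb' : ∀ j, |c j| ≤ N * R ^ j := fun j =>
    ((norm_snd_le _).trans (norm_snd_le _)).trans (hbound j)
  have hxb : ∀ j, |x j| ≤ M * R ^ j := fun j => (hxb' j).trans (hle j)
  have hab : ∀ j, |a j| ≤ M * R ^ j := fun j => (hab' j).trans (hle j)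
  have hcb : ∀ j, |c j| ≤ M * R ^ j := fun j => (hcb' j).trans (hle j)
  have hdb : ∀ j, |d j| ≤ M * R ^ j := fun j => by
    refine (abs_sub _ _).trans ?_
    rw [abs_mul, abs_of_nonneg hp]
    nlinarith [hcb' j, mul_le_mul_of_nonneg_left (hab' j) hp]
  have hwsucc : ∀ j, w (j + 1) = ∑ i : Fin (j + 1), einsteinQuad p q j (w i) (w (j - i)) :=
    fun j => by rw [hw, convRec]
  have hxrec : ∀ j : ℕ, x (j + 1) = -(∑ i : Fin (j + 1), a i * x (j - i)) / (j + 1) := fun j => by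
    simp only [hx, hwsucc, Prod.fst_sum, einsteinQuad, ha]
    rw [← Finset.sum_div, Finset.sum_neg_distrib]
  have harec : ∀ j : ℕ, a (j + 1) =
      (x (j + 1) - ∑ i : Fin (j + 1), c i * a (j - i)) / (2 * j + 3 + q) := fun j => by
    rw [hxrec]
    simp only [hx, hwsucc, Prod.fst_sum, Prod.snd_sum, einsteinQuad, ha, hc]
    rw [← Finset.sum_div, Finset.sum_sub_distrib, ← Finset.sum_div, Finset.sum_neg_distrib]
  have hcrec : ∀ j : ℕ, c (j + 1) =
      (2 * p * a (j + 1) - p * (∑ i : Fin (j + 1), a i * a (j - i)) -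
        (∑ i : Fin (j + 1), d i * d (j - i)) / q) / (2 * j + 5) := fun j => by
    rw [harec, hxrec]
    simp only [hx, hwsucc, Prod.snd_sum, einsteinQuad, ha, hc, hd]
    rw [← Finset.sum_div, Finset.sum_sub_distrib, Finset.sum_sub_distrib, ← Finset.sum_div,
      ← Finset.mul_sum, ← Finset.mul_sum, ← Finset.sum_div, Finset.sum_sub_distrib,
      ← Finset.sum_div, Finset.sum_neg_distrib]
  have hx0 : x 0 = x₀ := by simp [hx, hw, convRec]
  have ha0 : a 0 = P₀ := by simp [ha, hw, convRec]
  have hc0 : c 0 = C₀ := by simp [hc, hw, convRec]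
  have hball : Metric.ball (0 : ℝ) R⁻¹ = Ioo (-R⁻¹) R⁻¹ := by rw [Real.ball_eq_Ioo]; simp
  refine ⟨R⁻¹, by positivity, fun s => ∑' j, x j * s ^ j, fun s => ∑' j, a j * s ^ j,
    fun s => ∑' j, c j * s ^ j, ?_, ?_, ?_, ?_, ?_⟩
  · exact hball ▸ contDiffOn_tsum_mul_pow hR0 hxb
  · exact hball ▸ contDiffOn_tsum_mul_pow hR0 hab
  · exact hball ▸ contDiffOn_tsum_mul_pow hR0 hcb
  · change ∑' j, x j * (0 : ℝ) ^ j = x₀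
    rw [tsum_eq_single 0 (by intro j hj; simp [hj])]
    simp [hx0]
  · intro s hs
    have hsR : |s| * R < 1 := by
      rw [← lt_div_iff₀ hR0, one_div]
      exact abs_lt.2 hs
    obtain ⟨sx', dx⟩ := hasDerivAt_tsum_mul_pow hR0 hxb hsR
    obtain ⟨sa', da⟩ := hasDerivAt_tsum_mul_pow hR0 hab hsR
    obtain ⟨sc', dc⟩ := hasDerivAt_tsum_mul_pow hR0 hcb hsR
    obtain ⟨sx, ex⟩ := tsum_mul_pow_eq_zero_add hR0 hxb hsR
    obtain ⟨sa, ea⟩ := tsum_mul_pow_eq_zero_add hR0 hab hsR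
    obtain ⟨sc, ec⟩ := tsum_mul_pow_eq_zero_add hR0 hcb hsR
    have m1 := tsum_mul_pow_mul_tsum_mul_pow hR0 hab hxb hsR
    have m2 := tsum_mul_pow_mul_tsum_mul_pow hR0 hcb hab hsR
    have m3 := tsum_mul_pow_mul_tsum_mul_pow hR0 hab hab hsR
    have m4 := tsum_mul_pow_mul_tsum_mul_pow hR0 hdb hdb hsR
    have ed : ∑' j, d j * s ^ j = ∑' j, c j * s ^ j - p * ∑' j, a j * s ^ j := by
      rw [← tsum_mul_left, ← ((summable_norm_mul_pow_of_geometric_bound hR0 hcb hsR).of_norm).tsum_sub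
        (((summable_norm_mul_pow_of_geometric_bound hR0 hab hsR).of_norm).mul_left p)]
      refine tsum_congr fun j => ?_
      simp only [hd]
      ring
    have hj : ∀ j : ℕ, (0 : ℝ) ≤ j := fun j => Nat.cast_nonneg j
    have e1 : (fun j : ℕ => ((j : ℝ) + 1) * x (j + 1) * s ^ j) =
        fun j => -((∑ i : Fin (j + 1), a i * x (j - i)) * s ^ j) := by
      funext j
      have : (j : ℝ) + 1 ≠ 0 := by linarith [hj j]
      rw [hxrec]
      field_simp
    have e2 : (fun j : ℕ => 2 * (((j : ℝ) + 1) * a (j + 1) * s ^ j) +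
        (q + 1) * (a (j + 1) * s ^ j)) =
        fun j => x (j + 1) * s ^ j - (∑ i : Fin (j + 1), c i * a (j - i)) * s ^ j := by
      funext j
      have : 2 * (j : ℝ) + 3 + q ≠ 0 := by linarith [hj j]
      have h := (eq_div_iff this).1 (harec j)
      linear_combination s ^ j * h
    have e3 : (fun j : ℕ => 2 * (((j : ℝ) + 1) * c (j + 1) * s ^ j) + 3 * (c (j + 1) * s ^ j)) =
        fun j => 2 * p * (a (j + 1) * s ^ j) -
          p * ((∑ i : Fin (j + 1), a i * a (j - i)) * s ^ j) -
          ((∑ i : Fin (j + 1), d i * d (j - i)) * s ^ j) / q := by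
      funext j
      have : 2 * (j : ℝ) + 5 ≠ 0 := by linarith [hj j]
      have h := (eq_div_iff this).1 (hcrec j)
      linear_combination s ^ j * h
    have h1 := sx'.hasSum.unique (e1 ▸ m1.neg)
    have h2 := ((sa'.hasSum.mul_left 2).add (sa.hasSum.mul_left (q + 1))).unique
      (e2 ▸ sx.hasSum.sub m2)
    have h3 := ((sc'.hasSum.mul_left 2).add (sc.hasSum.mul_left 3)).unique
      (e3 ▸ ((sa.hasSum.mul_left (2 * p)).sub (m3.mul_left p)).sub (m4.div_const q))
    have hP₀' : (q + 1) * P₀ = x₀ - (p + q) := by rw [hP₀]; field_simp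
    have hC₀' : 3 * C₀ = 2 * p * P₀ - (p + q) := by rw [hC₀]; field_simp
    rw [ed] at h3
    rw [ha0] at ea
    rw [hx0] at ex
    rw [hc0] at ec
    refine ⟨_, _, _, dx, da, dc, h1, ?_, ?_⟩
    · linear_combination s * h2 + (q + 1) * ea - ex + hP₀'
    · linear_combination s * h3 + 3 * ec - 2 * p * ea + hC₀'

/-- The Einstein system as a first-order system for `X = (d₁ - 1) / f₁ ^ 2`, `a = f₁' / f₁` and
the mean curvature `Z`, with derivatives taken within `S`. -/
def IsEinsteinCurveAt (p q : ℝ) (X a Z : ℝ → ℝ) (S : Set ℝ) (t : ℝ) : Prop :=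
  HasDerivWithinAt X (-2 * a t * X t) S t ∧
  HasDerivWithinAt a (-(p + q) - Z t * a t + X t) S t ∧
  HasDerivWithinAt Z (-(p + q) - p * a t ^ 2 - (Z t - p * a t) ^ 2 / q) S t

theorem exists_local_einsteinCurve {p q : ℝ} (hp : 0 ≤ p) (hq : 1 ≤ q) (x₀ : ℝ) :
    ∃ r : ℝ, 0 < r ∧ ∃ X P C : ℝ → ℝ, ContDiffOn ℝ ∞ X (Ioo (-r) r) ∧
      ContDiffOn ℝ ∞ P (Ioo (-r) r) ∧ ContDiffOn ℝ ∞ C (Ioo (-r) r) ∧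
      (∀ t, X (-t) = X t) ∧ (∀ t, P (-t) = P t) ∧ (∀ t, C (-t) = C t) ∧ X 0 = x₀ ∧
      ∀ t ∈ Ioo 0 r, IsEinsteinCurveAt p q X (fun t => t * P t) (fun t => q / t + t * C t) univ t := by
  obtain ⟨r, hr, X, P, C, hX, hP, hC, hX0, h⟩ := exists_powerSeries_solution hp hq x₀
  have hmaps : MapsTo (fun t : ℝ => t ^ 2) (Ioo (-(min 1 r)) (min 1 r)) (Ioo (-r) r) := by
    intro t ht
    have h1 := abs_lt.2 ht
    have h2 := abs_nonneg t
    have h3 : |t| < 1 := h1.trans_le (min_le_left _ _)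
    have h4 : |t| < r := h1.trans_le (min_le_right _ _)
    have h5 : t ^ 2 = |t| ^ 2 := (sq_abs t).symm
    constructor <;> simp only [h5] <;> nlinarith
  have hsq : ContDiffOn ℝ ∞ (fun t : ℝ => t ^ 2) (Ioo (-(min 1 r)) (min 1 r)) := by fun_prop
  refine ⟨min 1 r, lt_min one_pos hr, fun t => X (t ^ 2), fun t => P (t ^ 2), fun t => C (t ^ 2),
    hX.comp hsq hmaps, hP.comp hsq hmaps, hC.comp hsq hmaps, fun t => by simp, fun t => by simp,
    fun t => by simp, by simpa using hX0, fun t ht => ?_⟩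
  obtain ⟨X', P', C', dX, dP, dC, e1, e2, e3⟩ :=
    h (t ^ 2) (hmaps ⟨by linarith [ht.1, lt_min one_pos hr], ht.2⟩)
  have ht0 : t ≠ 0 := ht.1.ne'
  have hq0 : q ≠ 0 := by positivity
  have dsq : HasDerivAt (fun t : ℝ => t ^ 2) (2 * t) t := by simpa using hasDerivAt_pow 2 t
  have dcomp : ∀ {F : ℝ → ℝ} {F' : ℝ}, HasDerivAt F F' (t ^ 2) →
      HasDerivAt (fun t => F (t ^ 2)) (F' * (2 * t)) t := fun {F} {F'} hF =>
    HasDerivAt.comp (h₂ := F) (h := fun t => t ^ 2) t hF dsq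
  have dP' : HasDerivAt (fun t => t * P (t ^ 2)) _ t := (hasDerivAt_id t).mul (dcomp dP)
  have dC' : HasDerivAt (fun t => q / t + t * C (t ^ 2)) _ t :=
    ((hasDerivAt_inv ht0).const_mul q).add ((hasDerivAt_id t).mul (dcomp dC))
  refine ⟨((dcomp dX).congr_deriv ?_).hasDerivWithinAt, (dP'.congr_deriv ?_).hasDerivWithinAt,
    (dC'.congr_deriv ?_).hasDerivWithinAt⟩
  · rw [e1]; ring
  · simp only [id]
    field_simp
    linear_combination e2
  · simp only [id]
    field_simp
    have e3' := congrArg (fun z => q * z) e3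
    simp only [mul_sub, mul_add] at e3'
    field_simp at e3'
    linear_combination t ^ 2 * e3'

theorem antitoneOn_of_hasDerivWithinAt_self_nonpos {D : Set ℝ} (hD : Convex ℝ D) {f f' : ℝ → ℝ}
    (hf : ∀ t ∈ D, HasDerivWithinAt f (f' t) D t) (hf' : ∀ t ∈ D, f' t ≤ 0) : AntitoneOn f D :=
  antitoneOn_of_hasDerivWithinAt_nonpos hD (fun t ht => (hf t ht).continuousWithinAt)
    (fun t ht => (hf t (interior_subset ht)).mono interior_subset)
    fun t ht => hf' t (interior_subset ht)

theorem pos_of_abs_deriv_le {y y' : ℝ → ℝ} {b c K : ℝ}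
    (hy : ∀ t ∈ Icc b c, HasDerivWithinAt y (y' t) (Icc b c) t)
    (hK : ∀ t ∈ Icc b c, |y' t| ≤ K * |y t|) (hb : 0 < y b) : ∀ t ∈ Icc b c, 0 < y t := by
  have hanti : AntitoneOn (fun t => -(y t ^ 2 * Real.exp (2 * K * t))) (Icc b c) := by
    refine antitoneOn_of_hasDerivWithinAt_self_nonpos (convex_Icc b c)
      (f' := fun t => -((2 * y t * y' t + 2 * K * y t ^ 2) * Real.exp (2 * K * t))) ?_ ?_
    · intro t ht
      have h1 : HasDerivAt (fun t : ℝ => Real.exp (2 * K * t)) (Real.exp (2 * K * t) * (2 * K)) t := by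
        simpa using ((hasDerivAt_id t).const_mul (2 * K)).exp
      refine ((((hy t ht).pow 2).mul h1.hasDerivWithinAt).neg).congr_deriv ?_
      simp
      ring
    · intro t ht
      have h1 := hK t ht
      have h2 : |y t * y' t| ≤ K * y t ^ 2 := by
        rw [abs_mul, ← sq_abs]
        nlinarith [abs_nonneg (y t)]
      have h3 := (abs_le.1 h2).1
      have h4 : 0 ≤ 2 * y t * y' t + 2 * K * y t ^ 2 := by nlinarith
      have := mul_nonneg h4 (Real.exp_pos (2 * K * t)).le
      linarith
  have hne : ∀ t ∈ Icc b c, y t ≠ 0 := by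
    intro t ht h0
    have := hanti (left_mem_Icc.2 (ht.1.trans ht.2)) ht ht.1
    have hb2 : 0 < y b ^ 2 * Real.exp (2 * K * b) := by positivity
    simp only [h0] at this
    norm_num at this
    linarith
  intro t ht
  by_contra hneg
  push Not at hneg
  have hcont : ContinuousOn y (Icc b t) := fun s hs =>
    (hy s ⟨hs.1, hs.2.trans ht.2⟩).continuousWithinAt.mono (Icc_subset_Icc_right ht.2)
  obtain ⟨s, hs, hs0⟩ := intermediate_value_Icc' ht.1 hcont ⟨hneg, hb.le⟩
  exact hne s ⟨hs.1, hs.2.trans ht.2⟩ hs0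

theorem exists_solution_of_lipschitz_of_bounded {E : Type*} [NormedAddCommGroup E]
    [NormedSpace ℝ E] [CompleteSpace E] {f : E → E} {K : NNReal} (hf : LipschitzWith K f) {L : NNReal}
    (hL : ∀ x, ‖f x‖ ≤ L) {b c : ℝ} (hbc : b ≤ c) (x₀ : E) :
    ∃ α : ℝ → E, α b = x₀ ∧ ∀ t ∈ Icc b c, HasDerivWithinAt α (f (α t)) (Icc b c) t := by
  have h : IsPicardLindelof (fun _ => f) (⟨b, left_mem_Icc.2 hbc⟩ : Icc b c) x₀
      (L * (c - b).toNNReal) 0 L K := by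
    refine IsPicardLindelof.of_time_independent (fun x _ => hL x) hf.lipschitzOnWith ?_
    simp [hbc]
  exact h.exists_eq_forall_mem_Icc_hasDerivWithinAt₀

/-- The vector field of the first-order Einstein system. -/
def einsteinField (p q : ℝ) (w : ℝ × ℝ × ℝ) : ℝ × ℝ × ℝ :=
  (-2 * w.2.1 * w.1, -(p + q) - w.2.2 * w.2.1 + w.1,
    -(p + q) - p * w.2.1 ^ 2 - (w.2.2 - p * w.2.1) ^ 2 / q)

theorem contDiff_einsteinField (p q : ℝ) {n : WithTop ℕ∞} : ContDiff ℝ n (einsteinField p q) := by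
  unfold einsteinField
  fun_prop

theorem exists_truncated_einsteinCurve (p q : ℝ) {R : ℝ} (hR : 0 ≤ R) {b c : ℝ} (hbc : b ≤ c)
    (X₀ a₀ Z₀ : ℝ) :
    ∃ X a Z : ℝ → ℝ, X b = X₀ ∧ a b = a₀ ∧ Z b = Z₀ ∧ ∀ t ∈ Icc b c,
      HasDerivWithinAt X (-2 * max (-R) (min R (a t)) * max 0 (min R (X t))) (Icc b c) t ∧
      HasDerivWithinAt a (-(p + q) - max 0 (min R (Z t)) * max (-R) (min R (a t)) +
        max 0 (min R (X t))) (Icc b c) t ∧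
      HasDerivWithinAt Z (-(p + q) - p * max (-R) (min R (a t)) ^ 2 -
        (max 0 (min R (Z t)) - p * max (-R) (min R (a t))) ^ 2 / q) (Icc b c) t := by
  set φ : ℝ × ℝ × ℝ → ℝ × ℝ × ℝ := fun w =>
    (max 0 (min R w.1), max (-R) (min R w.2.1), max 0 (min R w.2.2)) with hφ
  have hφL : LipschitzWith 1 φ := by
    have h1 : LipschitzWith 1 fun w : ℝ × ℝ × ℝ => max 0 (min R w.1) :=
      (LipschitzWith.prod_fst.const_min R).const_max 0
    have h2 : LipschitzWith 1 fun w : ℝ × ℝ × ℝ => max (-R) (min R w.2.1) :=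
      (((LipschitzWith.prod_fst.comp LipschitzWith.prod_snd).const_min R).const_max (-R)).weaken
        (by simp)
    have h3 : LipschitzWith 1 fun w : ℝ × ℝ × ℝ => max 0 (min R w.2.2) :=
      (((LipschitzWith.prod_snd.comp LipschitzWith.prod_snd).const_min R).const_max 0).weaken
        (by simp)
    exact (h1.prodMk (h2.prodMk h3)).weaken (by simp)
  have hφm : ∀ w, φ w ∈ Metric.closedBall (0 : ℝ × ℝ × ℝ) R := by
    intro w
    rw [mem_closedBall_zero_iff, Prod.norm_def, Prod.norm_def]
    have h : ∀ x : ℝ, ‖max 0 (min R x)‖ ≤ R := fun x => by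
      rw [Real.norm_eq_abs, abs_le]
      exact ⟨(neg_nonpos.2 hR).trans (le_max_left _ _), max_le hR (min_le_left _ _)⟩
    refine max_le (h _) (max_le ?_ (h _))
    rw [Real.norm_eq_abs, abs_le]
    exact ⟨le_max_left _ _, max_le (by linarith) (min_le_left _ _)⟩
  have hcpt := isCompact_closedBall (0 : ℝ × ℝ × ℝ) R
  obtain ⟨K, hK⟩ := (contDiff_einsteinField p q (n := 1)).contDiffOn.exists_lipschitzOnWith
    one_ne_zero (convex_closedBall (0 : ℝ × ℝ × ℝ) R) hcpt
  obtain ⟨L, hL⟩ := hcpt.exists_bound_of_continuousOn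
    (contDiff_einsteinField p q (n := 1)).continuous.continuousOn
  have hlip : LipschitzWith K fun w => einsteinField p q (φ w) := by
    intro u w
    refine (hK (hφm u) (hφm w)).trans ?_
    gcongr
    simpa using hφL u w
  obtain ⟨α, hα0, hα⟩ := exists_solution_of_lipschitz_of_bounded hlip (L := L.toNNReal)
    (fun w => (hL _ (hφm w)).trans (Real.le_coe_toNNReal L)) hbc (X₀, a₀, Z₀)
  refine ⟨fun t => (α t).1, fun t => (α t).2.1, fun t => (α t).2.2, by simp [hα0], by simp [hα0],
    by simp [hα0], fun t ht => ⟨(hα t ht).fst, (hα t ht).snd.fst, (hα t ht).snd.snd⟩⟩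

theorem le_of_clamped_einstein {p b c X₀ Z₀ : ℝ} (hp : 0 < p) {X Z ξ l Z' : ℝ → ℝ}
    (hX : ∀ t ∈ Icc b c, HasDerivWithinAt X (-2 * l t * ξ t) (Icc b c) t)
    (hZ : ∀ t ∈ Icc b c, HasDerivWithinAt Z (Z' t) (Icc b c) t)
    (hZ' : ∀ t ∈ Icc b c, Z' t ≤ -p * l t ^ 2)
    (hξ : ∀ t ∈ Icc b c, 0 ≤ ξ t ∧ ξ t ≤ X t) (hZ0 : ∀ t ∈ Icc b c, 0 ≤ Z t)
    (hXb : X b = X₀) (hZb : Z b = Z₀) :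
    ∀ t ∈ Icc b c, X t ≤ X₀ * Real.exp (Z₀ / p + (c - b)) := by
  have hanti : AntitoneOn (fun t => X t * Real.exp (Z t / p - (t - b))) (Icc b c) := by
    refine antitoneOn_of_hasDerivWithinAt_self_nonpos (convex_Icc b c)
      (f' := fun t => (-2 * l t * ξ t + X t * (Z' t / p - 1)) * Real.exp (Z t / p - (t - b))) ?_ ?_
    · intro t ht
      have h1 : HasDerivWithinAt (fun t : ℝ => Real.exp (Z t / p - (t - b)))
          (Real.exp (Z t / p - (t - b)) * (Z' t / p - 1)) (Icc b c) t :=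
        (((hZ t ht).div_const p).sub ((hasDerivWithinAt_id t _).sub_const b)).exp
      refine ((hX t ht).mul h1).congr_deriv ?_
      ring
    · intro t ht
      obtain ⟨h0, h1⟩ := hξ t ht
      have h2 : Z' t / p ≤ -l t ^ 2 := by
        rw [div_le_iff₀ hp]
        linarith [hZ' t ht]
      refine mul_nonpos_of_nonpos_of_nonneg ?_ (Real.exp_pos _).le
      nlinarith [mul_nonneg h0 (sq_nonneg (l t + 1)), mul_nonneg (sub_nonneg.2 h1) (sq_nonneg (l t)),
        mul_nonneg (h0.trans h1) (sub_nonneg.2 h2)]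
  intro t ht
  have h := hanti (left_mem_Icc.2 (ht.1.trans ht.2)) ht ht.1
  simp only [hXb, hZb, sub_self, sub_zero] at h
  have hX0 : 0 ≤ X t := (hξ t ht).1.trans (hξ t ht).2
  have hb0 : 0 ≤ X₀ := by
    have hb := hξ b (left_mem_Icc.2 (ht.1.trans ht.2))
    rw [← hXb]
    exact hb.1.trans hb.2
  have h3 : X t * Real.exp (Z t / p - (t - b)) * Real.exp (c - b) ≤
      X₀ * Real.exp (Z₀ / p) * Real.exp (c - b) := by gcongr
  rw [mul_assoc, ← Real.exp_add, mul_assoc, ← Real.exp_add] at h3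
  refine le_trans (le_mul_of_one_le_right hX0 (Real.one_le_exp ?_)) h3
  have := div_nonneg (hZ0 t ht) hp.le
  linarith [ht.2]

theorem sq_le_of_clamped_einstein {n b c a₀ K : ℝ} {a ξ l ζ : ℝ → ℝ}
    (ha : ∀ t ∈ Icc b c, HasDerivWithinAt a (-n - ζ t * l t + ξ t) (Icc b c) t)
    (hl : ∀ t ∈ Icc b c, 0 ≤ ζ t * (l t * a t)) (hξ : ∀ t ∈ Icc b c, |ξ t - n| ≤ K)
    (hab : a b = a₀) :
    ∀ t ∈ Icc b c, a t ^ 2 ≤ (a₀ ^ 2 + K ^ 2) * Real.exp (c - b) := by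
  have hanti : AntitoneOn (fun t => (a t ^ 2 + K ^ 2) * Real.exp (-(t - b))) (Icc b c) := by
    refine antitoneOn_of_hasDerivWithinAt_self_nonpos (convex_Icc b c)
      (f' := fun t => (2 * a t * (-n - ζ t * l t + ξ t) - (a t ^ 2 + K ^ 2)) *
        Real.exp (-(t - b))) ?_ ?_
    · intro t ht
      have h1 : HasDerivWithinAt (fun t : ℝ => Real.exp (-(t - b)))
          (Real.exp (-(t - b)) * (-1)) (Icc b c) t :=
        ((hasDerivWithinAt_id t _).sub_const b).neg.exp
      refine ((((ha t ht).pow 2).add_const (K ^ 2)).mul h1).congr_deriv ?_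
      simp
      ring
    · intro t ht
      refine mul_nonpos_of_nonpos_of_nonneg ?_ (Real.exp_pos _).le
      have h1 := hl t ht
      have h2 : (ξ t - n) ^ 2 ≤ K ^ 2 := sq_le_sq' (abs_le.1 (hξ t ht)).1 (abs_le.1 (hξ t ht)).2
      nlinarith [sq_nonneg (a t - (ξ t - n))]
  intro t ht
  have h := hanti (left_mem_Icc.2 (ht.1.trans ht.2)) ht ht.1
  simp only [hab, sub_self, neg_zero, Real.exp_zero, mul_one] at h
  rw [Real.exp_neg, ← div_eq_mul_inv, div_le_iff₀ (Real.exp_pos _)] at h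
  have h3 : (a₀ ^ 2 + K ^ 2) * Real.exp (t - b) ≤ (a₀ ^ 2 + K ^ 2) * Real.exp (c - b) := by
    gcongr
    exact ht.2
  nlinarith [sq_nonneg K]

theorem exists_einsteinCurve_until_maximal {p q : ℝ} (hp : 0 < p) (hq : 0 < q) {t₀ X₀ a₀ Z₀ : ℝ}
    (hX₀ : 0 < X₀) (hZ₀ : 0 < Z₀) :
    ∃ T > t₀, ∃ X a Z : ℝ → ℝ, X t₀ = X₀ ∧ a t₀ = a₀ ∧ Z t₀ = Z₀ ∧
      (∀ t ∈ Icc t₀ T, IsEinsteinCurveAt p q X a Z (Icc t₀ T) t) ∧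
      (∀ t ∈ Icc t₀ T, 0 < X t) ∧ (∀ t ∈ Ico t₀ T, 0 < Z t) ∧ Z T = 0 := by
  have hn : 0 < p + q := by positivity
  set T₀ := Z₀ / (p + q) with hT₀
  have hT₀pos : 0 < T₀ := by positivity
  set M := X₀ * Real.exp (Z₀ / p + T₀) with hM
  have hMpos : 0 < M := by positivity
  set N := (a₀ ^ 2 + (M + (p + q)) ^ 2) * Real.exp T₀ with hN
  have hNpos : 0 < N := by positivity
  set R := M + Z₀ + N + 1 with hR
  have hRpos : 0 ≤ R := by positivity
  obtain ⟨X, a, Z, hX, ha, hZ, hsol⟩ := exists_truncated_einsteinCurve p q hRpos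
    (show t₀ ≤ t₀ + T₀ by linarith) X₀ a₀ Z₀
  set Z' : ℝ → ℝ := fun t => -(p + q) - p * max (-R) (min R (a t)) ^ 2 -
    (max 0 (min R (Z t)) - p * max (-R) (min R (a t))) ^ 2 / q with hZ'
  have hZ'le : ∀ t, Z' t ≤ -(p + q) ∧ Z' t ≤ -p * max (-R) (min R (a t)) ^ 2 := by
    intro t
    have h1 : 0 ≤ (max 0 (min R (Z t)) - p * max (-R) (min R (a t))) ^ 2 / q := by positivity
    have h2 : 0 ≤ p * max (-R) (min R (a t)) ^ 2 := by positivity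
    simp only [hZ']
    constructor <;> linarith
  have hZcont : ContinuousOn Z (Icc t₀ (t₀ + T₀)) := fun t ht => (hsol t ht).2.2.continuousWithinAt
  have hanti : AntitoneOn (fun t => Z t + (p + q) * t) (Icc t₀ (t₀ + T₀)) := by
    refine antitoneOn_of_hasDerivWithinAt_self_nonpos (convex_Icc _ _)
      (f' := fun t => Z' t + (p + q) * 1)
      (fun t ht => (hsol t ht).2.2.add ((hasDerivWithinAt_id t _).const_mul (p + q))) ?_
    intro t _
    linarith [(hZ'le t).1]
  have hZend : Z (t₀ + T₀) ≤ 0 := by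
    have h := hanti (left_mem_Icc.2 (by linarith)) (right_mem_Icc.2 (by linarith))
      (by linarith : t₀ ≤ t₀ + T₀)
    have h2 : (p + q) * T₀ = Z₀ := by
      rw [hT₀]
      field_simp
    simp only [hZ] at h
    linarith
  obtain ⟨T, hT, hZT⟩ := intermediate_value_Icc' (by linarith) hZcont ⟨hZend, hZ.symm ▸ hZ₀.le⟩
  have hTgt : t₀ < T := by
    refine lt_of_le_of_ne hT.1 fun h => ?_
    rw [← h, hZ] at hZT
    exact hZ₀.ne' hZT
  have hsub : Icc t₀ T ⊆ Icc t₀ (t₀ + T₀) := Icc_subset_Icc_right hT.2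
  have hZpos : ∀ t ∈ Ico t₀ T, 0 < Z t := by
    intro t ht
    have h := hanti (hsub ⟨ht.1, ht.2.le⟩) hT ht.2.le
    simp only [hZT] at h
    nlinarith [ht.2]
  have hZnn : ∀ t ∈ Icc t₀ T, 0 ≤ Z t := by
    intro t ht
    rcases eq_or_lt_of_le ht.2 with h | h
    · rw [h, hZT]
    · exact (hZpos t ⟨ht.1, h⟩).le
  have hZle : ∀ t ∈ Icc t₀ T, Z t ≤ Z₀ := by
    intro t ht
    have h := hanti (left_mem_Icc.2 (by linarith)) (hsub ht) ht.1
    simp only [hZ] at h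
    nlinarith [ht.1]
  have hXd := fun t (ht : t ∈ Icc t₀ T) => (hsol t (hsub ht)).1.mono hsub
  have had := fun t (ht : t ∈ Icc t₀ T) => (hsol t (hsub ht)).2.1.mono hsub
  have hZd := fun t (ht : t ∈ Icc t₀ T) => (hsol t (hsub ht)).2.2.mono hsub
  have hlR : ∀ x, |max (-R) (min R x)| ≤ R := fun x =>
    abs_le.2 ⟨le_max_left _ _, max_le (by linarith) (min_le_left _ _)⟩
  have hXpos : ∀ t ∈ Icc t₀ T, 0 < X t := by
    refine pos_of_abs_deriv_le (K := 2 * R) hXd (fun t _ => ?_) (hX ▸ hX₀)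
    have h1 : |max 0 (min R (X t))| ≤ |X t| := by
      rw [abs_of_nonneg (le_max_left _ _)]
      exact max_le (abs_nonneg _) ((min_le_right _ _).trans (le_abs_self _))
    rw [abs_mul, abs_mul]
    norm_num
    gcongr
    exact hlR _
  have hξ : ∀ t ∈ Icc t₀ T, 0 ≤ max 0 (min R (X t)) ∧ max 0 (min R (X t)) ≤ X t := fun t ht =>
    ⟨le_max_left _ _, max_le (hXpos t ht).le (min_le_right _ _)⟩
  have hXle : ∀ t ∈ Icc t₀ T, X t ≤ M := by
    intro t ht
    refine (le_of_clamped_einstein hp hXd hZd (fun t _ => (hZ'le t).2) hξ hZnn hX hZ t ht).trans ?_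
    rw [hM]
    gcongr
    linarith [hT.2]
  have hale : ∀ t ∈ Icc t₀ T, a t ^ 2 ≤ N := by
    intro t ht
    refine (sq_le_of_clamped_einstein (K := M + (p + q)) had (fun t _ => ?_) (fun t ht => ?_) ha t
      ht).trans ?_
    · refine mul_nonneg (le_max_left _ _) ?_
      rcases le_total 0 (a t) with h | h
      · exact mul_nonneg (le_max_of_le_right (le_min hRpos h)) h
      · exact mul_nonneg_of_nonpos_of_nonpos
          (max_le (by linarith) ((min_le_right _ _).trans h)) h
    · have h := hξ t ht
      have h2 := hXle t ht
      rw [abs_le]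
      constructor <;> linarith
    · rw [hN]
      gcongr
      linarith [hT.2]
  refine ⟨T, hTgt, X, a, Z, hX, ha, hZ, fun t ht => ?_, hXpos, hZpos, hZT⟩
  have e1 : max 0 (min R (X t)) = X t := by
    rw [min_eq_right (by linarith [hXle t ht]), max_eq_right (hXpos t ht).le]
  have e2 : max 0 (min R (Z t)) = Z t := by
    rw [min_eq_right (by linarith [hZle t ht]), max_eq_right (hZnn t ht)]
  have habs : |a t| ≤ R := abs_le_of_sq_le_sq (by nlinarith [hale t ht]) hRpos
  have e3 : max (-R) (min R (a t)) = a t := by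
    rw [min_eq_right (abs_le.1 habs).2, max_eq_right (abs_le.1 habs).1]
  have h1 := hXd t ht
  have h2 := had t ht
  have h3 := hZd t ht
  rw [e1, e3] at h1
  rw [e1, e2, e3] at h2
  simp only [e2, e3] at h3
  exact ⟨h1, h2, h3⟩

theorem contDiffOn_of_isEinsteinCurveAt {p q : ℝ} {X a Z : ℝ → ℝ} {S : Set ℝ}
    (hS : UniqueDiffOn ℝ S) (h : ∀ t ∈ S, IsEinsteinCurveAt p q X a Z S t) :
    ContDiffOn ℝ ∞ X S ∧ ContDiffOn ℝ ∞ a S ∧ ContDiffOn ℝ ∞ Z S := by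
  have key : ∀ n : ℕ, ContDiffOn ℝ n X S ∧ ContDiffOn ℝ n a S ∧ ContDiffOn ℝ n Z S := by
    intro n
    induction n with
    | zero =>
      simp only [Nat.cast_zero, contDiffOn_zero]
      exact ⟨fun t ht => (h t ht).1.continuousWithinAt, fun t ht => (h t ht).2.1.continuousWithinAt,
        fun t ht => (h t ht).2.2.continuousWithinAt⟩
    | succ n ih =>
      obtain ⟨hX, ha, hZ⟩ := ih
      have step : ∀ {f f' : ℝ → ℝ}, (∀ t ∈ S, HasDerivWithinAt f (f' t) S t) →
          ContDiffOn ℝ n f' S → ContDiffOn ℝ ((n + 1 : ℕ) : WithTop ℕ∞) f S := by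
        intro f f' hf hf'
        rw [Nat.cast_add, Nat.cast_one, contDiffOn_succ_iff_derivWithin hS]
        refine ⟨fun t ht => (hf t ht).differentiableWithinAt, by simp, ?_⟩
        exact hf'.congr fun t ht => (hf t ht).derivWithin (hS t ht)
      refine ⟨step (fun t ht => (h t ht).1) ?_, step (fun t ht => (h t ht).2.1) ?_,
        step (fun t ht => (h t ht).2.2) ?_⟩
      · exact (contDiffOn_const.mul ha).mul hX
      · exact (contDiffOn_const.sub (hZ.mul ha)).add hX
      · exact (contDiffOn_const.sub (contDiffOn_const.mul (ha.pow 2))).sub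
          (((hZ.sub (contDiffOn_const.mul ha)).pow 2).div_const q)
  exact ⟨contDiffOn_infty.2 fun n => (key n).1, contDiffOn_infty.2 fun n => (key n).2.1,
    contDiffOn_infty.2 fun n => (key n).2.2⟩

theorem IsEinsteinCurveAt.congr_mono {p q : ℝ} {X a Z X' a' Z' : ℝ → ℝ} {S S' : Set ℝ} {t : ℝ}
    (h : IsEinsteinCurveAt p q X a Z S t) (hS : S' ⊆ S) (ht : t ∈ S') (hX : EqOn X' X S')
    (ha : EqOn a' a S') (hZ : EqOn Z' Z S') : IsEinsteinCurveAt p q X' a' Z' S' t := by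
  obtain ⟨h1, h2, h3⟩ := h
  rw [IsEinsteinCurveAt, hX ht, ha ht, hZ ht]
  exact ⟨(h1.mono hS).congr hX (hX ht), (h2.mono hS).congr ha (ha ht),
    (h3.mono hS).congr hZ (hZ ht)⟩

theorem IsEinsteinCurveAt.union {p q : ℝ} {X a Z : ℝ → ℝ} {S S' : Set ℝ} {t : ℝ}
    (h : IsEinsteinCurveAt p q X a Z S t) (h' : IsEinsteinCurveAt p q X a Z S' t) :
    IsEinsteinCurveAt p q X a Z (S ∪ S') t :=
  ⟨h.1.union h'.1, h.2.1.union h'.2.1, h.2.2.union h'.2.2⟩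

theorem IsEinsteinCurveAt.mono_of_mem_nhdsWithin {p q : ℝ} {X a Z : ℝ → ℝ} {S S' : Set ℝ} {t : ℝ}
    (h : IsEinsteinCurveAt p q X a Z S t) (hS : S ∈ 𝓝[S'] t) :
    IsEinsteinCurveAt p q X a Z S' t :=
  ⟨h.1.mono_of_mem_nhdsWithin hS, h.2.1.mono_of_mem_nhdsWithin hS,
    h.2.2.mono_of_mem_nhdsWithin hS⟩

/-- The value of `(d₂ - 1) / f₂ ^ 2` forced by the Einstein equations in terms of
`X = (d₁ - 1) / f₁ ^ 2`, `a = f₁' / f₁` and the mean curvature `Z`. -/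
def secondCurvature (p q : ℝ) (X a Z : ℝ → ℝ) (t : ℝ) : ℝ :=
  ((p + q) ^ 2 - (p + q) + Z t ^ 2 - p * a t ^ 2 - (Z t - p * a t) ^ 2 / q - p * X t) / q

theorem IsEinsteinCurveAt.hasDerivWithinAt_secondCurvature {p q : ℝ} (hq : q ≠ 0) {X a Z : ℝ → ℝ}
    {S : Set ℝ} {t : ℝ} (h : IsEinsteinCurveAt p q X a Z S t) :
    HasDerivWithinAt (secondCurvature p q X a Z)
      (-2 * ((Z t - p * a t) / q) * secondCurvature p q X a Z t) S t := by
  obtain ⟨hX, ha, hZ⟩ := h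
  have := (((((hZ.pow 2).const_add ((p + q) ^ 2 - (p + q))).sub ((ha.pow 2).const_mul p)).sub
    (((hZ.sub (ha.const_mul p)).pow 2).div_const q)).sub (hX.const_mul p)).div_const q
  refine this.congr_deriv ?_
  simp only [secondCurvature, Pi.sub_apply]
  field_simp
  ring

theorem exists_einsteinCurve {p q : ℝ} (hp : 0 < p) (hq : 1 < q) {x₀ : ℝ} (hx₀ : 0 < x₀) :
    ∃ r T : ℝ, 0 < r ∧ r < T ∧ ∃ X₀ W X a Z : ℝ → ℝ,
      ContDiffOn ℝ ∞ X₀ (Ioo (-r) r) ∧ ContDiffOn ℝ ∞ W (Ioo (-r) r) ∧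
      (∀ t, X₀ (-t) = X₀ t) ∧ (∀ t, W (-t) = W t) ∧
      (∀ t ∈ Ioo (-r) r, 0 < X₀ t) ∧ (∀ t ∈ Ioo (-r) r, 0 < W t) ∧ X₀ 0 = x₀ ∧ W 0 = q - 1 ∧
      (∀ t ∈ Ioo 0 r, X t = X₀ t) ∧
      (∀ t ∈ Ioo 0 r, t ^ 2 * secondCurvature p q X a Z t = W t) ∧
      (∀ t ∈ Ioc 0 T, IsEinsteinCurveAt p q X a Z (Ioc 0 T) t) ∧
      (∀ t ∈ Ioc 0 T, 0 < X t) ∧ (∀ t ∈ Ioc 0 T, 0 < secondCurvature p q X a Z t) ∧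
      (∀ t ∈ Ioo 0 T, 0 < Z t) ∧ Z T = 0 := by
  have hq0 : 0 < q := by linarith
  obtain ⟨ρ, hρ, X₀, P, C, hX₀, hP, hC, hX₀e, hPe, hCe, hX₀0, hloc⟩ :=
    exists_local_einsteinCurve hp.le hq.le x₀
  set W : ℝ → ℝ := fun t => (t ^ 2 * ((p + q) ^ 2 - (p + q)) + (q + t ^ 2 * C t) ^ 2 -
    p * t ^ 4 * P t ^ 2 - (q + t ^ 2 * (C t - p * P t)) ^ 2 / q - p * t ^ 2 * X₀ t) / q with hW
  have hWd : ContDiffOn ℝ ∞ W (Ioo (-ρ) ρ) := by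
    simp only [hW]
    fun_prop
  have hW0 : W 0 = q - 1 := by
    simp only [hW]
    field_simp
    ring
  have hnhds : Ioo (-ρ) ρ ∈ 𝓝 (0 : ℝ) := Ioo_mem_nhds (by linarith) hρ
  have hV : ContinuousAt (fun t => q + t ^ 2 * C t) 0 := by
    have := hC.continuousOn.continuousAt hnhds
    fun_prop
  have hev : ∀ᶠ t in 𝓝 (0 : ℝ), 0 < X₀ t ∧ 0 < W t ∧ 0 < q + t ^ 2 * C t :=
    ((hX₀.continuousOn.continuousAt hnhds).eventually (lt_mem_nhds (by rw [hX₀0]; exact hx₀))).and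
      (((hWd.continuousOn.continuousAt hnhds).eventually
        (lt_mem_nhds (by rw [hW0]; linarith))).and
        (hV.eventually (lt_mem_nhds (by simpa using hq0))))
  obtain ⟨δ, hδ, hball⟩ := Metric.eventually_nhds_iff.1 hev
  obtain ⟨r, hr, hrm⟩ := exists_between (lt_min hδ hρ)
  have hrδ := hrm.trans_le (min_le_left _ _)
  have hrρ := hrm.trans_le (min_le_right _ _)
  have hpos : ∀ t ∈ Icc (-r) r, 0 < X₀ t ∧ 0 < W t ∧ 0 < q + t ^ 2 * C t := by
    intro t ht
    refine hball ?_
    rw [Real.dist_eq, sub_zero]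
    exact (abs_le.2 ht).trans_lt hrδ
  have hZloc : ∀ t, 0 < t → q / t + t * C t = (q + t ^ 2 * C t) / t := by
    intro t ht
    field_simp
  have hrmem : r ∈ Icc (-r) r := ⟨by linarith, le_rfl⟩
  obtain ⟨T, hT, X₁, a₁, Z₁, hX₁, ha₁, hZ₁, hsol, hX₁pos, hZ₁pos, hZ₁T⟩ :=
    exists_einsteinCurve_until_maximal hp hq0 (t₀ := r) (X₀ := X₀ r) (a₀ := r * P r)
      (Z₀ := q / r + r * C r) (hpos r hrmem).1
      (by rw [hZloc r hr]; exact div_pos (hpos r hrmem).2.2 hr)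
  set X : ℝ → ℝ := fun t => if t ≤ r then X₀ t else X₁ t with hX
  set a : ℝ → ℝ := fun t => if t ≤ r then t * P t else a₁ t with ha
  set Z : ℝ → ℝ := fun t => if t ≤ r then q / t + t * C t else Z₁ t with hZ
  have hle : ∀ t ≤ r, X t = X₀ t ∧ a t = t * P t ∧ Z t = q / t + t * C t := fun t ht => by
    simp [hX, ha, hZ, ht]
  have hge : ∀ t ∈ Icc r T, X t = X₁ t ∧ a t = a₁ t ∧ Z t = Z₁ t := by
    intro t ht
    rcases eq_or_lt_of_le ht.1 with h | h
    · subst h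
      rw [hX₁, ha₁, hZ₁]
      exact hle _ le_rfl
    · simp [hX, ha, hZ, not_le.2 h]
  have hcurve₀ : ∀ t ∈ Ioc 0 r, IsEinsteinCurveAt p q X a Z (Ioc 0 r) t := fun t ht =>
    (hloc t ⟨ht.1, ht.2.trans_lt hrρ⟩).congr_mono (subset_univ _) ht
      (fun s hs => (hle s hs.2).1) (fun s hs => (hle s hs.2).2.1) (fun s hs => (hle s hs.2).2.2)
  have hcurve₁ : ∀ t ∈ Icc r T, IsEinsteinCurveAt p q X a Z (Icc r T) t := fun t ht =>
    (hsol t ht).congr_mono subset_rfl ht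
      (fun s hs => (hge s hs).1) (fun s hs => (hge s hs).2.1) (fun s hs => (hge s hs).2.2)
  have hcurve : ∀ t ∈ Ioc 0 T, IsEinsteinCurveAt p q X a Z (Ioc 0 T) t := by
    intro t ht
    rcases lt_trichotomy t r with h | h | h
    · refine (hcurve₀ t ⟨ht.1, h.le⟩).mono_of_mem_nhdsWithin ?_
      filter_upwards [self_mem_nhdsWithin, mem_nhdsWithin_of_mem_nhds (Iio_mem_nhds h)] with s hs hs'
      exact ⟨hs.1, le_of_lt hs'⟩
    · subst h
      have := (hcurve₀ t ⟨ht.1, le_rfl⟩).union (hcurve₁ t ⟨le_rfl, ht.2⟩)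
      rwa [Ioc_union_Icc_eq_Ioc ht.1 ht.2] at this
    · refine (hcurve₁ t ⟨h.le, ht.2⟩).mono_of_mem_nhdsWithin ?_
      filter_upwards [self_mem_nhdsWithin, mem_nhdsWithin_of_mem_nhds (Ioi_mem_nhds h)] with s hs hs'
      exact ⟨le_of_lt hs', hs.2⟩
  have hYW : ∀ t ∈ Ioc 0 r, t ^ 2 * secondCurvature p q X a Z t = W t := by
    intro t ht
    obtain ⟨h1, h2, h3⟩ := hle t ht.2
    have := ht.1.ne'
    simp only [secondCurvature, h1, h2, h3, hW]
    field_simp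
    ring
  have hYpos₀ : ∀ t ∈ Ioc 0 r, 0 < secondCurvature p q X a Z t := by
    intro t ht
    have h := (hpos t ⟨by linarith [ht.1], ht.2⟩).2.1
    rw [← hYW t ht] at h
    exact pos_of_mul_pos_right h (sq_nonneg t)
  have hYpos₁ : ∀ t ∈ Icc r T, 0 < secondCurvature p q X a Z t := by
    have hcont : ContinuousOn (fun t => (Z t - p * a t) / q) (Icc r T) := fun t ht =>
      (((hcurve₁ t ht).2.2.continuousWithinAt).sub
        ((hcurve₁ t ht).2.1.continuousWithinAt.const_mul p)).div_const q
    obtain ⟨K, hK⟩ := isCompact_Icc.exists_bound_of_continuousOn hcont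
    refine pos_of_abs_deriv_le (K := 2 * K)
      (fun t ht => (hcurve₁ t ht).hasDerivWithinAt_secondCurvature hq0.ne') (fun t ht => ?_)
      (hYpos₀ r ⟨hr, le_rfl⟩)
    rw [abs_mul, abs_mul]
    norm_num only [abs_neg, Nat.abs_ofNat]
    gcongr
    exact hK t ht
  have hsub : Ioo (-r) r ⊆ Ioo (-ρ) ρ := Ioo_subset_Ioo (by linarith) hrρ.le
  refine ⟨r, T, hr, hT, X₀, W, X, a, Z, hX₀.mono hsub, hWd.mono hsub, hX₀e, ?_,
    fun t ht => (hpos t (Ioo_subset_Icc_self ht)).1,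
    fun t ht => (hpos t (Ioo_subset_Icc_self ht)).2.1, hX₀0, hW0,
    fun t ht => (hle t ht.2.le).1, fun t ht => hYW t (Ioo_subset_Ioc_self ht), hcurve, ?_, ?_, ?_,
    ?_⟩
  · intro t
    simp only [hW, hX₀e, hPe, hCe, even_two.neg_pow, (by decide : Even 4).neg_pow]
  · intro t ht
    rcases le_total t r with h | h
    · rw [(hle t h).1]
      exact (hpos t ⟨by linarith [ht.1], h⟩).1
    · rw [(hge t ⟨h, ht.2⟩).1]
      exact hX₁pos t ⟨h, ht.2⟩
  · intro t ht
    rcases le_total t r with h | h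
    · exact hYpos₀ t ⟨ht.1, h⟩
    · exact hYpos₁ t ⟨h, ht.2⟩
  · intro t ht
    rcases le_total t r with h | h
    · rw [(hle t h).2.2, hZloc t ht.1]
      exact div_pos (hpos t ⟨by linarith [ht.1], h⟩).2.2 ht.1
    · rw [(hge t ⟨h, ht.2.le⟩).2.2]
      exact hZ₁pos t ⟨h, ht.2⟩
  · rw [(hge T ⟨hT.le, le_rfl⟩).2.2, hZ₁T]

theorem exists_contDiffOn_extension {g h : ℝ → ℝ} {s r T : ℝ} (hs : s * s = 1) (hr : 0 < r)
    (hg : ContDiffOn ℝ ∞ g (Ioc 0 T)) (hh : ContDiffOn ℝ ∞ h (Ioo (-r) r))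
    (hpar : ∀ t, h (-t) = s * h t) (hgh : ∀ t ∈ Ioo 0 r, g t = h t) :
    ∃ F : ℝ → ℝ, ContDiffOn ℝ ∞ F (Ioc (-T) T) ∧ (∀ t, F (-t) = s * F t) ∧
      (∀ t, 0 < t → F t = g t) ∧ ∀ t ∈ Ioo (-r) r, F t = h t := by
  set F : ℝ → ℝ := fun t => if 0 < t then g t else if t = 0 then h 0 else s * g (-t) with hF
  have hFpos : ∀ t, 0 < t → F t = g t := fun t ht => by simp [hF, ht]
  have hFneg : ∀ t, t < 0 → F t = s * g (-t) := fun t ht => by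
    simp [hF, ht.le.not_gt, ht.ne]
  have hF0 : F 0 = h 0 := by simp [hF]
  have hFh : ∀ t ∈ Ioo (-r) r, F t = h t := by
    intro t ht
    rcases lt_trichotomy t 0 with h0 | h0 | h0
    · rw [hFneg t h0, hgh (-t) ⟨by linarith, by linarith [ht.1]⟩, hpar, ← mul_assoc, hs, one_mul]
    · rw [h0, hF0]
    · rw [hFpos t h0, hgh t ⟨h0, ht.2⟩]
  refine ⟨F, fun t ht => ?_, fun t => ?_, hFpos, hFh⟩
  · rcases lt_trichotomy t 0 with h0 | h0 | h0
    · have h1 : ContDiffAt ℝ ∞ g (-t) :=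
        hg.contDiffAt (Ioc_mem_nhds (by linarith) (by linarith [ht.1]))
      have h2 : ContDiffAt ℝ ∞ (fun t => s * g (-t)) t :=
        contDiffAt_const.mul (h1.comp t contDiff_neg.contDiffAt)
      refine (h2.congr_of_eventuallyEq ?_).contDiffWithinAt
      filter_upwards [Iio_mem_nhds h0] with u hu using hFneg u hu
    · subst h0
      refine ((hh.contDiffAt (Ioo_mem_nhds (by linarith) hr)).congr_of_eventuallyEq
        ?_).contDiffWithinAt
      filter_upwards [Ioo_mem_nhds (show -r < 0 by linarith) hr] with u hu using hFh u hu
    · have h1 : ContDiffWithinAt ℝ ∞ g (Ioc (-T) T) t := by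
        refine (hg t ⟨h0, ht.2⟩).mono_of_mem_nhdsWithin ?_
        filter_upwards [self_mem_nhdsWithin, mem_nhdsWithin_of_mem_nhds (Ioi_mem_nhds h0)]
          with u hu hu' using ⟨hu', hu.2⟩
      refine h1.congr_of_eventuallyEq ?_ (hFpos t h0)
      filter_upwards [mem_nhdsWithin_of_mem_nhds (Ioi_mem_nhds h0)] with u hu using hFpos u hu
  · rcases lt_trichotomy t 0 with h0 | h0 | h0
    · rw [hFneg t h0, hFpos _ (by linarith), ← mul_assoc, hs, one_mul]
    · have := hpar 0
      rw [neg_zero] at this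
      rw [h0, neg_zero, hF0, ← this]
    · rw [hFpos t h0, hFneg _ (by linarith), neg_neg]

theorem hasDerivWithinAt_sqrt_div {X : ℝ → ℝ} {S : Set ℝ} {c a t : ℝ} (hc : 0 < c) (hX : 0 < X t)
    (h : HasDerivWithinAt X (-2 * a * X t) S t) :
    HasDerivWithinAt (fun t => √(c / X t)) (a * √(c / X t)) S t := by
  have hpos : 0 < c / X t := div_pos hc hX
  have h1 := (((hasDerivWithinAt_const t S c).div h hX.ne').sqrt hpos.ne')
  refine h1.congr_deriv ?_
  have h2 : √(c / X t) ≠ 0 := (Real.sqrt_pos.2 hpos).ne'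
  have h3 : c / X t = √(c / X t) ^ 2 := (Real.sq_sqrt hpos.le).symm
  have h4 : (0 * X t - c * (-2 * a * X t)) / X t ^ 2 = 2 * a * (c / X t) := by
    field_simp
    ring
  simp only [Pi.div_apply]
  rw [h4]
  nth_rewrite 1 [h3]
  field_simp

theorem dIoc_eq_of_hasDerivWithinAt {T t g' : ℝ} {F g : ℝ → ℝ} (ht : t ∈ Ioc 0 T)
    (hF : EqOn F g (Ioc 0 T)) (hg : HasDerivWithinAt g g' (Ioc 0 T) t) : dIoc T F t = g' := by
  have hlt : -T < T := by linarith [ht.1, ht.2]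
  have h1 : HasDerivWithinAt F g' (Ioc (-T) T) t := by
    refine (hg.congr hF (hF ht)).mono_of_mem_nhdsWithin ?_
    filter_upwards [self_mem_nhdsWithin, mem_nhdsWithin_of_mem_nhds (Ioi_mem_nhds ht.1)]
      with u hu hu' using ⟨hu', hu.2⟩
  exact h1.derivWithin (uniqueDiffOn_Ioc _ _ t ⟨by linarith [ht.1], ht.2⟩)

theorem exists_einsteinIVPSol {d₁ d₂ : ℕ} (hd₁ : 2 ≤ d₁) (hd₂ : 2 ≤ d₂) {α : ℝ} (hα : 0 < α) :
    ∃ T : ℝ, 0 < T ∧ ∃ f₁ f₂ : ℝ → ℝ, EinsteinIVPSol d₁ d₂ α T f₁ f₂ := by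
  obtain ⟨p, hp⟩ : ∃ p : ℝ, p = d₁ := ⟨_, rfl⟩
  obtain ⟨q, hq⟩ : ∃ q : ℝ, q = d₂ := ⟨_, rfl⟩
  have hp2 : 2 ≤ p := by rw [hp]; exact_mod_cast hd₁
  have hq2 : 2 ≤ q := by rw [hq]; exact_mod_cast hd₂
  have hq0 : q ≠ 0 := by linarith
  have hp1 : 0 < p - 1 := by linarith
  have hq1 : 0 < q - 1 := by linarith
  obtain ⟨r, T, hr, hrT, X₀, W, X, a, Z, hX₀, hW, hX₀e, hWe, hX₀pos, hWpos, hX₀0, hW0, hXX₀, hYW,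
    hsol, hXpos, hYpos, hZpos, hZT⟩ := exists_einsteinCurve (p := p) (q := q) (by linarith)
      (by linarith) (x₀ := α ^ 2) (by positivity)
  have hT : 0 < T := hr.trans hrT
  set Y := secondCurvature p q X a Z with hY
  set L : ℝ → ℝ := fun t => (Z t - p * a t) / q with hL
  have hU : UniqueDiffOn ℝ (Ioc 0 T) := uniqueDiffOn_Ioc _ _
  obtain ⟨hXs, has, hZs⟩ := contDiffOn_of_isEinsteinCurveAt hU hsol
  have hYs : ContDiffOn ℝ ∞ Y (Ioc 0 T) := by
    simp only [hY]
    unfold secondCurvature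
    fun_prop
  have h0r : (0 : ℝ) ∈ Ioo (-r) r := ⟨by linarith, hr⟩
  have hk : ContDiffOn ℝ ∞ (fun t => √((q - 1) / W t)) (Ioo (-r) r) :=
    (contDiffOn_const.div hW fun t ht => (hWpos t ht).ne').sqrt
      fun t ht => (div_pos hq1 (hWpos t ht)).ne'
  obtain ⟨f₁, hf₁s, hf₁e, hf₁g, hf₁h⟩ := exists_contDiffOn_extension (T := T)
    (g := fun t => √((p - 1) / X t)) (h := fun t => √((p - 1) / X₀ t)) (one_mul 1) hr
    ((contDiffOn_const.div hXs fun t ht => (hXpos t ht).ne').sqrt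
      fun t ht => (div_pos hp1 (hXpos t ht)).ne')
    ((contDiffOn_const.div hX₀ fun t ht => (hX₀pos t ht).ne').sqrt
      fun t ht => (div_pos hp1 (hX₀pos t ht)).ne')
    (fun t => by simp only [hX₀e, one_mul]) (fun t ht => by simp only [hXX₀ t ht])
  obtain ⟨f₂, hf₂s, hf₂e, hf₂g, hf₂h⟩ := exists_contDiffOn_extension (T := T)
    (g := fun t => √((q - 1) / Y t)) (h := fun t => t * √((q - 1) / W t)) (s := -1) (by norm_num) hr
    ((contDiffOn_const.div hYs fun t ht => (hYpos t ht).ne').sqrt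
      fun t ht => (div_pos hq1 (hYpos t ht)).ne')
    (contDiffOn_id.mul hk)
    (fun t => by simp only [hWe]; ring) (fun t ht => by
      simp only [← hYW t ht]
      rw [← Real.sqrt_sq ht.1.le, ← Real.sqrt_mul (sq_nonneg t), Real.sqrt_sq ht.1.le]
      congr 1
      have h1 := ht.1.ne'
      have h2 := (hYpos t ⟨ht.1, (ht.2.trans hrT).le⟩).ne'
      field_simp)
  have hf₁g' : EqOn f₁ (fun t => √((p - 1) / X t)) (Ioc 0 T) := fun t ht => hf₁g t ht.1
  have hf₂g' : EqOn f₂ (fun t => √((q - 1) / Y t)) (Ioc 0 T) := fun t ht => hf₂g t ht.1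
  have hf₁d : ∀ t ∈ Ioc 0 T, HasDerivWithinAt f₁ (a t * f₁ t) (Ioc 0 T) t := by
    intro t ht
    rw [hf₁g' ht]
    exact (hasDerivWithinAt_sqrt_div hp1 (hXpos t ht) (hsol t ht).1).congr hf₁g' (hf₁g' ht)
  have hf₂d : ∀ t ∈ Ioc 0 T, HasDerivWithinAt f₂ (L t * f₂ t) (Ioc 0 T) t := by
    intro t ht
    rw [hf₂g' ht]
    exact (hasDerivWithinAt_sqrt_div hq1 (hYpos t ht)
      ((hsol t ht).hasDerivWithinAt_secondCurvature hq0)).congr hf₂g' (hf₂g' ht)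
  have hD₁ : EqOn (dIoc T f₁) (fun t => a t * f₁ t) (Ioc 0 T) := fun t ht =>
    dIoc_eq_of_hasDerivWithinAt ht (eqOn_refl _ _) (hf₁d t ht)
  have hD₂ : EqOn (dIoc T f₂) (fun t => L t * f₂ t) (Ioc 0 T) := fun t ht =>
    dIoc_eq_of_hasDerivWithinAt ht (eqOn_refl _ _) (hf₂d t ht)
  have hDD₁ := fun t (ht : t ∈ Ioc 0 T) =>
    dIoc_eq_of_hasDerivWithinAt ht hD₁ ((hsol t ht).2.1.mul (hf₁d t ht))
  have hDD₂ := fun t (ht : t ∈ Ioc 0 T) =>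
    dIoc_eq_of_hasDerivWithinAt ht hD₂
      ((((hsol t ht).2.2.sub ((hsol t ht).2.1.const_mul p)).div_const q).mul (hf₂d t ht))
  have hf₁pos : ∀ t ∈ Ioc 0 T, 0 < f₁ t := fun t ht => by
    rw [hf₁g' ht]
    exact Real.sqrt_pos.2 (div_pos hp1 (hXpos t ht))
  have hf₂pos : ∀ t ∈ Ioc 0 T, 0 < f₂ t := fun t ht => by
    rw [hf₂g' ht]
    exact Real.sqrt_pos.2 (div_pos hq1 (hYpos t ht))
  have hf₁0 : f₁ 0 = √(p - 1) / α := by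
    rw [hf₁h 0 h0r, hX₀0, Real.sqrt_div hp1.le, Real.sqrt_sq hα.le]
  have hZfun : ∀ t ∈ Ioc 0 T, Zfun d₁ d₂ T f₁ f₂ t = Z t := by
    intro t ht
    have h1 := (hf₁pos t ht).ne'
    have h2 := (hf₂pos t ht).ne'
    rw [Zfun, hD₁ ht, hD₂ ht, ← hp, ← hq]
    simp only [hL]
    field_simp
    ring
  have hX_eq : ∀ t ∈ Ioc 0 T, (p - 1) / f₁ t ^ 2 = X t := by
    intro t ht
    have := (hXpos t ht).ne'
    rw [hf₁g' ht, Real.sq_sqrt (div_pos hp1 (hXpos t ht)).le]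
    field_simp
  have hY_eq : ∀ t ∈ Ioc 0 T, (q - 1) / f₂ t ^ 2 = Y t := by
    intro t ht
    have := (hYpos t ht).ne'
    rw [hf₂g' ht, Real.sq_sqrt (div_pos hq1 (hYpos t ht)).le]
    field_simp
  refine ⟨T, hT, f₁, f₂, hf₁s, hf₂s, fun t _ => by simpa using hf₁e t,
    fun t _ => by simpa using hf₂e t, ?_, hf₂pos, by rw [← hp, hf₁0], ?_, ?_,
    fun t ht => by rw [hZfun t ⟨ht.1, ht.2.le⟩]; exact hZpos t ht,
    by rw [hZfun T ⟨hT, le_rfl⟩, hZT]⟩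
  · intro t ht
    rcases eq_or_lt_of_le ht.1 with h | h
    · rw [← h, hf₁0]
      exact div_pos (Real.sqrt_pos.2 hp1) hα
    · exact hf₁pos t ⟨h, ht.2⟩
  · have h1 := ((hk.contDiffAt (Ioo_mem_nhds h0r.1 h0r.2)).differentiableAt (by simp)).hasDerivAt
    have h2 := (hasDerivAt_id (0 : ℝ)).mul h1
    have h3 : HasDerivAt f₂ 1 0 := by
      refine (h2.congr_of_eventuallyEq (f₁ := f₂) ?_).congr_deriv ?_
      · filter_upwards [Ioo_mem_nhds h0r.1 h0r.2] with t ht using hf₂h t ht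
      · simp [hW0, hq1.ne']
    exact h3.hasDerivWithinAt.derivWithin (uniqueDiffOn_Ioc _ _ 0 ⟨by linarith, hT.le⟩)
  · intro t ht
    have h1 := (hf₁pos t ht).ne'
    have h2 := (hf₂pos t ht).ne'
    rw [hDD₁ t ht, hDD₂ t ht, hD₁ ht, hD₂ ht, ← hp, ← hq, hX_eq t ht, hY_eq t ht]
    have e3 : Y t = ((p + q) ^ 2 - (p + q) + Z t ^ 2 - p * a t ^ 2 - (Z t - p * a t) ^ 2 / q -
      p * X t) / q := rfl
    rw [e3]
    simp only [hL, Pi.sub_apply]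
    refine ⟨?_, ?_, ?_⟩ <;> field_simp <;> ring

theorem mul_le_abs_mul_of_abs_le {k w e : ℝ} (hw : |w| ≤ e) : k * w ≤ |k| * e := by
  refine (le_abs_self _).trans ?_
  rw [abs_mul]
  gcongr

theorem einsteinEnergy_deriv_le {p q t M X₁ X₂ a₁ a₂ c₁ c₂ Z₁ Z₂ : ℝ} (hp : 1 ≤ p) (hq : 1 ≤ q)
    (ht : 0 < t) (hZ₁ : Z₁ = c₁ + q / t) (hZ₂ : Z₂ = c₂ + q / t)
    (hM : |2 * a₁| + |p ^ 2 - 2 * X₂| + |p ^ 2 * c₁| +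
      |p * ((c₁ - p * a₁) + (c₂ - p * a₂)) / q - p ^ 2 * a₂ - p * (a₁ + a₂)| +
      |((c₁ - p * a₁) + (c₂ - p * a₂)) / q| ≤ M) :
    2 * (X₁ - X₂) * (-2 * a₁ * X₁ - -2 * a₂ * X₂) +
      p ^ 2 * (2 * (a₁ - a₂) * ((-(p + q) - Z₁ * a₁ + X₁) - (-(p + q) - Z₂ * a₂ + X₂))) +
      2 * (Z₁ - Z₂) * ((-(p + q) - p * a₁ ^ 2 - (Z₁ - p * a₁) ^ 2 / q) -
        (-(p + q) - p * a₂ ^ 2 - (Z₂ - p * a₂) ^ 2 / q)) ≤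
    2 * M * ((X₁ - X₂) ^ 2 + p ^ 2 * (a₁ - a₂) ^ 2 + (c₁ - c₂) ^ 2) := by
  have ht0 : t ≠ 0 := ht.ne'
  have hq0 : q ≠ 0 := by linarith
  obtain ⟨x, hx⟩ : ∃ x, x = X₁ - X₂ := ⟨_, rfl⟩
  obtain ⟨y, hy⟩ : ∃ y, y = a₁ - a₂ := ⟨_, rfl⟩
  obtain ⟨z, hz⟩ : ∃ z, z = c₁ - c₂ := ⟨_, rfl⟩
  obtain ⟨s, hs⟩ : ∃ s, s = (c₁ - p * a₁) + (c₂ - p * a₂) := ⟨_, rfl⟩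
  have hsplit : 2 * (X₁ - X₂) * (-2 * a₁ * X₁ - -2 * a₂ * X₂) +
      p ^ 2 * (2 * (a₁ - a₂) * ((-(p + q) - Z₁ * a₁ + X₁) - (-(p + q) - Z₂ * a₂ + X₂))) +
      2 * (Z₁ - Z₂) * ((-(p + q) - p * a₁ ^ 2 - (Z₁ - p * a₁) ^ 2 / q) -
        (-(p + q) - p * a₂ ^ 2 - (Z₂ - p * a₂) ^ 2 / q)) =
      2 / t * (-(p ^ 2 * q * y ^ 2) - 2 * z ^ 2 + 2 * p * y * z) +
      2 * (-(2 * a₁) * x ^ 2 + (p ^ 2 - 2 * X₂) * (x * y) + -(p ^ 2 * c₁) * y ^ 2 +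
        (p * s / q - p ^ 2 * a₂ - p * (a₁ + a₂)) * (y * z) + -(s / q) * z ^ 2) := by
    rw [hZ₁, hZ₂, hx, hy, hz, hs]
    field_simp
    ring
  have hsing : 2 / t * (-(p ^ 2 * q * y ^ 2) - 2 * z ^ 2 + 2 * p * y * z) ≤ 0 := by
    refine mul_nonpos_of_nonneg_of_nonpos (by positivity) ?_
    have h : -(p ^ 2 * q * y ^ 2) - 2 * z ^ 2 + 2 * p * y * z =
        -((p * y - z) ^ 2 + z ^ 2 + (q - 1) * (p * y) ^ 2) := by ring
    have hq1 := sub_nonneg.2 hq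
    rw [h, neg_nonpos]
    positivity
  rw [← hs] at hM
  rw [hsplit, ← hx, ← hy, ← hz]
  obtain ⟨e, he⟩ : ∃ e, e = x ^ 2 + p ^ 2 * y ^ 2 + z ^ 2 := ⟨_, rfl⟩
  rw [← he]
  have hE : x ^ 2 + y ^ 2 + z ^ 2 ≤ e := by
    rw [he]
    have h := mul_le_mul_of_nonneg_right (one_le_pow₀ hp (n := 2)) (sq_nonneg y)
    linarith only [h]
  have hEnn : 0 ≤ e := le_trans (by positivity) hE
  have b1 := mul_le_abs_mul_of_abs_le (k := -(2 * a₁)) (w := x ^ 2) (e := e) (by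
    rw [abs_le]; constructor <;> nlinarith only [hE, sq_nonneg x, sq_nonneg y, sq_nonneg z])
  have b2 := mul_le_abs_mul_of_abs_le (k := p ^ 2 - 2 * X₂) (w := x * y) (e := e) (by
    rw [abs_le]
    constructor <;> nlinarith only [hE, sq_nonneg (x + y), sq_nonneg (x - y), sq_nonneg z])
  have b3 := mul_le_abs_mul_of_abs_le (k := -(p ^ 2 * c₁)) (w := y ^ 2) (e := e) (by
    rw [abs_le]; constructor <;> nlinarith only [hE, sq_nonneg x, sq_nonneg y, sq_nonneg z])
  have b4 := mul_le_abs_mul_of_abs_le (k := p * s / q - p ^ 2 * a₂ - p * (a₁ + a₂)) (w := y * z)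
    (e := e) (by
      rw [abs_le]
      constructor <;> nlinarith only [hE, sq_nonneg (y + z), sq_nonneg (y - z), sq_nonneg x])
  have b5 := mul_le_abs_mul_of_abs_le (k := -(s / q)) (w := z ^ 2) (e := e) (by
    rw [abs_le]; constructor <;> nlinarith only [hE, sq_nonneg x, sq_nonneg y, sq_nonneg z])
  rw [abs_neg] at b1 b3 b5
  have := mul_le_mul_of_nonneg_right hM hEnn
  linarith only [b1, b2, b3, b4, b5, this, hsing]

theorem eqOn_of_isEinsteinCurveAt {p q τ : ℝ} (hp : 1 ≤ p) (hq : 1 ≤ q) (hτ : 0 ≤ τ)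
    {X₁ a₁ Z₁ X₂ a₂ Z₂ : ℝ → ℝ}
    (h₁ : ∀ t ∈ Ioc 0 τ, IsEinsteinCurveAt p q X₁ a₁ Z₁ (Ioc 0 τ) t)
    (h₂ : ∀ t ∈ Ioc 0 τ, IsEinsteinCurveAt p q X₂ a₂ Z₂ (Ioc 0 τ) t)
    (hX₁ : ContinuousOn X₁ (Icc 0 τ)) (ha₁ : ContinuousOn a₁ (Icc 0 τ))
    (hc₁ : ContinuousOn (fun t => Z₁ t - q / t) (Icc 0 τ))
    (hX₂ : ContinuousOn X₂ (Icc 0 τ)) (ha₂ : ContinuousOn a₂ (Icc 0 τ))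
    (hc₂ : ContinuousOn (fun t => Z₂ t - q / t) (Icc 0 τ))
    (hX : X₁ 0 = X₂ 0) (ha : a₁ 0 = a₂ 0) (hZ : Z₁ 0 = Z₂ 0) :
    EqOn X₁ X₂ (Ioc 0 τ) ∧ EqOn a₁ a₂ (Ioc 0 τ) ∧ EqOn Z₁ Z₂ (Ioc 0 τ) := by
  set c₁ : ℝ → ℝ := fun t => Z₁ t - q / t with hc₁'
  set c₂ : ℝ → ℝ := fun t => Z₂ t - q / t with hc₂'
  set s : ℝ → ℝ := fun t => (c₁ t - p * a₁ t) + (c₂ t - p * a₂ t) with hs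
  set E : ℝ → ℝ := fun t =>
    (X₁ t - X₂ t) ^ 2 + p ^ 2 * (a₁ t - a₂ t) ^ 2 + (c₁ t - c₂ t) ^ 2 with hE
  set E' : ℝ → ℝ := fun t => 2 * (X₁ t - X₂ t) * (-2 * a₁ t * X₁ t - -2 * a₂ t * X₂ t) +
    p ^ 2 * (2 * (a₁ t - a₂ t) * ((-(p + q) - Z₁ t * a₁ t + X₁ t) -
      (-(p + q) - Z₂ t * a₂ t + X₂ t))) +
    2 * (Z₁ t - Z₂ t) * ((-(p + q) - p * a₁ t ^ 2 - (Z₁ t - p * a₁ t) ^ 2 / q) -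
      (-(p + q) - p * a₂ t ^ 2 - (Z₂ t - p * a₂ t) ^ 2 / q)) with hE'
  have hEcont : ContinuousOn E (Icc 0 τ) := by fun_prop
  have hBcont : ContinuousOn (fun t => |2 * a₁ t| + |p ^ 2 - 2 * X₂ t| + |p ^ 2 * c₁ t| +
      |p * s t / q - p ^ 2 * a₂ t - p * (a₁ t + a₂ t)| + |s t / q|) (Icc 0 τ) := by
    fun_prop (disch := positivity)
  obtain ⟨M, hM⟩ := isCompact_Icc.exists_bound_of_continuousOn hBcont
  have hEd : ∀ t ∈ Ioo 0 τ, HasDerivAt E (E' t) t := by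
    intro t ht
    have hnhds : Ioc 0 τ ∈ 𝓝 t := Ioc_mem_nhds ht.1 ht.2
    obtain ⟨u1, u2, u3⟩ := h₁ t (Ioo_subset_Ioc_self ht)
    obtain ⟨v1, v2, v3⟩ := h₂ t (Ioo_subset_Ioc_self ht)
    have hfun : E = fun t =>
        (X₁ t - X₂ t) ^ 2 + p ^ 2 * (a₁ t - a₂ t) ^ 2 + (Z₁ t - Z₂ t) ^ 2 := by
      funext t
      simp only [hE, hc₁', hc₂', sub_sub_sub_cancel_right]
    rw [hfun]
    refine (((((u1.hasDerivAt hnhds).sub (v1.hasDerivAt hnhds)).pow 2).add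
      ((((u2.hasDerivAt hnhds).sub (v2.hasDerivAt hnhds)).pow 2).const_mul (p ^ 2))).add
      (((u3.hasDerivAt hnhds).sub (v3.hasDerivAt hnhds)).pow 2)).congr_deriv ?_
    simp [hE']
  have hE'le : ∀ t ∈ Ioo 0 τ, E' t ≤ 2 * M * E t := by
    intro t ht
    have hB := hM t (Ioo_subset_Icc_self ht)
    rw [Real.norm_eq_abs, abs_of_nonneg (by positivity)] at hB
    refine einsteinEnergy_deriv_le hp hq ht.1 (c₁ := c₁ t) (c₂ := c₂ t) ?_ ?_ hB
    · simp [hc₁']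
    · simp [hc₂']
  have hanti : AntitoneOn (fun t => E t * Real.exp (-(2 * M) * t)) (Icc 0 τ) := by
    refine antitoneOn_of_hasDerivWithinAt_nonpos (convex_Icc 0 τ)
      (f' := fun t => (E' t - 2 * M * E t) * Real.exp (-(2 * M) * t)) (by fun_prop) ?_ ?_
    · rw [interior_Icc]
      intro t ht
      have h1 : HasDerivAt (fun t : ℝ => Real.exp (-(2 * M) * t))
          (Real.exp (-(2 * M) * t) * (-(2 * M))) t := by
        simpa using ((hasDerivAt_id t).const_mul (-(2 * M))).exp
      refine (((hEd t ht).mul h1).congr_deriv ?_).hasDerivWithinAt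
      ring
    · rw [interior_Icc]
      intro t ht
      exact mul_nonpos_of_nonpos_of_nonneg (by linarith [hE'le t ht]) (Real.exp_pos _).le
  have hE0 : ∀ t ∈ Ioc 0 τ, E t ≤ 0 := by
    intro t ht
    have h := hanti (left_mem_Icc.2 hτ) (Ioc_subset_Icc_self ht) ht.1.le
    have h0 : E 0 = 0 := by simp [hE, hc₁', hc₂', hX, ha, hZ]
    simp only [h0, zero_mul] at h
    exact nonpos_of_mul_nonpos_left h (Real.exp_pos _)
  have hzero : ∀ t ∈ Ioc 0 τ, X₁ t - X₂ t = 0 ∧ a₁ t - a₂ t = 0 ∧ Z₁ t - Z₂ t = 0 := by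
    intro t ht
    have h := hE0 t ht
    simp only [hE, hc₁', hc₂', sub_sub_sub_cancel_right] at h
    have hp0 : 0 < p ^ 2 := by positivity
    have i1 := sq_nonneg (X₁ t - X₂ t)
    have i2 := mul_nonneg hp0.le (sq_nonneg (a₁ t - a₂ t))
    have i3 := sq_nonneg (Z₁ t - Z₂ t)
    have j2 : p ^ 2 * (a₁ t - a₂ t) ^ 2 = 0 := by linarith
    refine ⟨pow_eq_zero_iff two_ne_zero |>.1 (by linarith), ?_,
      pow_eq_zero_iff two_ne_zero |>.1 (by linarith)⟩
    exact pow_eq_zero_iff two_ne_zero |>.1 ((mul_eq_zero.1 j2).resolve_left hp0.ne')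
  exact ⟨fun t ht => sub_eq_zero.1 (hzero t ht).1, fun t ht => sub_eq_zero.1 (hzero t ht).2.1,
    fun t ht => sub_eq_zero.1 (hzero t ht).2.2⟩

theorem hasDerivAt_zero_of_even {f : ℝ → ℝ} {f' : ℝ} (h : HasDerivAt f f' 0)
    (heven : ∀ᶠ t in 𝓝 0, f (-t) = f t) : f' = 0 := by
  have h1 : HasDerivAt (fun t => f (-t)) (-f') 0 := by
    have h2 : HasDerivAt f f' (-0) := by rwa [neg_zero]
    exact (h2.comp (0 : ℝ) (hasDerivAt_neg (0 : ℝ))).congr_deriv (by ring)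
  have := (h1.congr_of_eventuallyEq (heven.mono fun t ht => ht.symm)).unique h
  linarith

theorem tendsto_deriv_div_sub_inv {f f' f'' : ℝ → ℝ} (hf0 : f 0 = 0) (hf'0 : f' 0 = 1)
    (hf : ∀ᶠ t in 𝓝 0, HasDerivAt f (f' t) t) (hf' : ∀ᶠ t in 𝓝 0, HasDerivAt f' (f'' t) t)
    (hf'' : Tendsto f'' (𝓝[>] 0) (𝓝 0)) :
    Tendsto (fun t => f' t / f t - 1 / t) (𝓝[>] 0) (𝓝 0) := by
  have hg : Tendsto f (𝓝[>] 0) (𝓝 0) := by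
    have := hf.self_of_nhds.continuousAt.tendsto
    rw [hf0] at this
    exact this.mono_left nhdsWithin_le_nhds
  have hg' : Tendsto f' (𝓝[>] 0) (𝓝 1) := by
    have := hf'.self_of_nhds.continuousAt.tendsto
    rw [hf'0] at this
    exact this.mono_left nhdsWithin_le_nhds
  have hid : Tendsto (fun t : ℝ => t) (𝓝[>] 0) (𝓝 0) := tendsto_id.mono_left nhdsWithin_le_nhds
  have h1 : Tendsto (fun t => f t / t) (𝓝[>] 0) (𝓝 1) :=
    HasDerivAt.lhopital_zero_nhdsGT (f' := f') (g' := fun _ => 1)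
      (hf.filter_mono nhdsWithin_le_nhds) (Eventually.of_forall fun t => hasDerivAt_id t)
      (Eventually.of_forall fun _ => one_ne_zero) hg hid (by simpa using hg')
  have h2 : Tendsto (fun t => (t * f' t - f t) / t ^ 2) (𝓝[>] 0) (𝓝 0) := by
    refine HasDerivAt.lhopital_zero_nhdsGT (f' := fun t => t * f'' t) (g' := fun t => 2 * t)
      ?_ (Eventually.of_forall fun t => by simpa using hasDerivAt_pow 2 t) ?_ ?_ ?_ ?_
    · filter_upwards [hf.filter_mono nhdsWithin_le_nhds, hf'.filter_mono nhdsWithin_le_nhds]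
        with t ht ht'
      refine (((hasDerivAt_id t).mul ht').sub ht).congr_deriv ?_
      simp
    · filter_upwards [self_mem_nhdsWithin] with t (ht : 0 < t)
      exact mul_ne_zero two_ne_zero ht.ne'
    · simpa using (hid.mul hg').sub hg
    · simpa using hid.pow 2
    · have := hf''.div_const 2
      rw [zero_div] at this
      refine this.congr' ?_
      filter_upwards [self_mem_nhdsWithin] with t (ht : 0 < t)
      have := ht.ne'
      field_simp
  have h3 := h2.div h1 one_ne_zero
  rw [zero_div] at h3
  refine h3.congr' ?_
  filter_upwards [self_mem_nhdsWithin, h1.eventually_ne one_ne_zero] with t (ht : 0 < t) hne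
  have h4 := ht.ne'
  have h5 : f t ≠ 0 := fun h => hne (by rw [h, zero_div])
  simp only [Pi.div_apply]
  field_simp

theorem hasDerivWithinAt_dIoc {T t : ℝ} {f : ℝ → ℝ} (hf : ContDiffOn ℝ ∞ f (Ioc (-T) T))
    (ht : t ∈ Ioc (-T) T) : HasDerivWithinAt f (dIoc T f t) (Ioc (-T) T) t :=
  ((hf.differentiableOn (by simp)) t ht).hasDerivWithinAt

theorem contDiffOn_dIoc {T : ℝ} {f : ℝ → ℝ} (hf : ContDiffOn ℝ ∞ f (Ioc (-T) T)) :
    ContDiffOn ℝ ∞ (dIoc T f) (Ioc (-T) T) :=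
  hf.derivWithin (uniqueDiffOn_Ioc _ _) (by simp)

theorem dIoc_even_of_odd {T : ℝ} {f : ℝ → ℝ} (hf : ∀ t ∈ Ioo (-T) T, f (-t) = -f t) :
    ∀ t ∈ Ioo (-T) T, dIoc T f (-t) = dIoc T f t := by
  have h : ∀ t ∈ Ioo (-T) T, dIoc T f t = deriv f t := fun t ht =>
    derivWithin_of_mem_nhds (Ioc_mem_nhds ht.1 ht.2)
  intro t ht
  have hev : f =ᶠ[𝓝 t] fun u => -f (-u) := by
    filter_upwards [Ioo_mem_nhds ht.1 ht.2] with u hu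
    rw [hf u hu, neg_neg]
  rw [h t ht, h (-t) ⟨by linarith [ht.2], by linarith [ht.1]⟩, hev.deriv_eq, deriv.fun_neg,
    deriv_comp_neg, neg_neg]

section EinsteinIVPSol

variable {d₁ d₂ : ℕ} {α T : ℝ} {f₁ f₂ : ℝ → ℝ}

theorem EinsteinIVPSol.isEinsteinCurveAt (h : EinsteinIVPSol d₁ d₂ α T f₁ f₂) (hd₂ : 0 < d₂) :
    ∀ t ∈ Ioc 0 T, IsEinsteinCurveAt d₁ d₂ (fun t => (d₁ - 1) / f₁ t ^ 2)
      (fun t => dIoc T f₁ t / f₁ t) (Zfun d₁ d₂ T f₁ f₂) (Ioc 0 T) t := by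
  obtain ⟨hf₁, hf₂, -, -, hpos₁, hpos₂, -, -, hode, -⟩ := h
  have hq : (d₂ : ℝ) ≠ 0 := by exact_mod_cast hd₂.ne'
  intro t ht
  have hsub : Ioc 0 T ⊆ Ioc (-T) T := Ioc_subset_Ioc_left (by linarith [ht.1, ht.2])
  have u1 := (hasDerivWithinAt_dIoc hf₁ (hsub ht)).mono hsub
  have u2 := (hasDerivWithinAt_dIoc (contDiffOn_dIoc hf₁) (hsub ht)).mono hsub
  have v1 := (hasDerivWithinAt_dIoc hf₂ (hsub ht)).mono hsub
  have v2 := (hasDerivWithinAt_dIoc (contDiffOn_dIoc hf₂) (hsub ht)).mono hsub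
  have n1 := (hpos₁ t ⟨ht.1.le, ht.2⟩).ne'
  have n2 := (hpos₂ t ht).ne'
  obtain ⟨e1, e2, -⟩ := hode t ht
  refine ⟨?_, ?_, ?_⟩
  · refine ((hasDerivWithinAt_const t _ ((d₁ : ℝ) - 1)).div (u1.pow 2)
      (pow_ne_zero 2 n1)).congr_deriv ?_
    simp only [Pi.pow_apply]
    field_simp
    ring
  · refine (u2.div u1 n1).congr_deriv ?_
    rw [Zfun]
    have e2' : dIoc T (dIoc T f₁) t / f₁ t = -((d₁ : ℝ) + d₂) - ((d₁ : ℝ) - 1) *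
      (dIoc T f₁ t) ^ 2 / (f₁ t) ^ 2 - (d₂ : ℝ) * (dIoc T f₁ t * dIoc T f₂ t) / (f₁ t * f₂ t)
      + ((d₁ : ℝ) - 1) / (f₁ t) ^ 2 := by linarith
    have : (dIoc T (dIoc T f₁) t * f₁ t - dIoc T f₁ t * dIoc T f₁ t) / f₁ t ^ 2 =
        dIoc T (dIoc T f₁) t / f₁ t - (dIoc T f₁ t / f₁ t) ^ 2 := by
      field_simp
    rw [this, e2']
    field_simp
    ring
  · refine (((u2.const_mul (d₁ : ℝ)).div u1 n1).add
      ((v2.const_mul (d₂ : ℝ)).div v1 n2)).congr_deriv ?_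
    have : (d₁ * dIoc T (dIoc T f₁) t * f₁ t - d₁ * dIoc T f₁ t * dIoc T f₁ t) / f₁ t ^ 2 +
        (d₂ * dIoc T (dIoc T f₂) t * f₂ t - d₂ * dIoc T f₂ t * dIoc T f₂ t) / f₂ t ^ 2 =
        (d₁ * dIoc T (dIoc T f₁) t / f₁ t + d₂ * dIoc T (dIoc T f₂) t / f₂ t) -
          d₁ * (dIoc T f₁ t / f₁ t) ^ 2 - d₂ * (dIoc T f₂ t / f₂ t) ^ 2 := by
      field_simp
      ring
    rw [this, e1, Zfun]
    field_simp
    ring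

theorem EinsteinIVPSol.secondCurvature_eq (h : EinsteinIVPSol d₁ d₂ α T f₁ f₂) (hd₂ : 0 < d₂) :
    ∀ t ∈ Ioc 0 T, secondCurvature d₁ d₂ (fun t => (d₁ - 1) / f₁ t ^ 2)
      (fun t => dIoc T f₁ t / f₁ t) (Zfun d₁ d₂ T f₁ f₂) t = (d₂ - 1) / f₂ t ^ 2 := by
  obtain ⟨-, -, -, -, hpos₁, hpos₂, -, -, hode, -⟩ := h
  have hq : (d₂ : ℝ) ≠ 0 := by exact_mod_cast hd₂.ne'
  intro t ht
  have n1 := (hpos₁ t ⟨ht.1.le, ht.2⟩).ne'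
  have n2 := (hpos₂ t ht).ne'
  obtain ⟨e1, e2, e3⟩ := hode t ht
  rw [secondCurvature, Zfun, div_eq_iff hq]
  have e : (d₂ : ℝ) * (((d₂ : ℝ) - 1) / f₂ t ^ 2) = (d₁ + d₂ : ℝ) ^ 2 - (d₁ + d₂) +
      d₁ * (d₁ - 1) * (dIoc T f₁ t / f₁ t) ^ 2 + d₂ * (d₂ - 1) * (dIoc T f₂ t / f₂ t) ^ 2 +
      2 * d₁ * d₂ * (dIoc T f₁ t / f₁ t) * (dIoc T f₂ t / f₂ t) -
      d₁ * ((d₁ - 1) / f₁ t ^ 2) := by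
    have e1' : (d₁ : ℝ) * (dIoc T (dIoc T f₁) t / f₁ t) + d₂ * (dIoc T (dIoc T f₂) t / f₂ t) =
        -(d₁ + d₂) := by rw [← e1]; ring
    have hx : (d₁ * (dIoc T f₁ t * dIoc T f₂ t) / (f₁ t * f₂ t) : ℝ) =
      d₁ * ((dIoc T f₁ t / f₁ t) * (dIoc T f₂ t / f₂ t)) := by field_simp
    have hy : (d₂ * (dIoc T f₁ t * dIoc T f₂ t) / (f₁ t * f₂ t) : ℝ) =
      d₂ * ((dIoc T f₁ t / f₁ t) * (dIoc T f₂ t / f₂ t)) := by field_simp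
    rw [hy, mul_div_assoc, ← div_pow] at e2
    rw [hx, mul_div_assoc, ← div_pow] at e3
    linear_combination e1' - (d₁ : ℝ) * e2 - (d₂ : ℝ) * e3
  rw [mul_comm _ (d₂ : ℝ), e]
  field_simp
  ring

theorem EinsteinIVPSol.curvature_zero (h : EinsteinIVPSol d₁ d₂ α T f₁ f₂) (hd₁ : 1 < d₁)
    (hα : 0 < α) : ((d₁ : ℝ) - 1) / f₁ 0 ^ 2 = α ^ 2 := by
  obtain ⟨-, -, -, -, -, -, h0, -⟩ := h
  have hp : (0 : ℝ) < d₁ - 1 := by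
    have : (1 : ℝ) < d₁ := by exact_mod_cast hd₁
    linarith
  rw [h0, div_pow, Real.sq_sqrt hp.le]
  have := hp.ne'
  field_simp

theorem EinsteinIVPSol.dIoc_zero (h : EinsteinIVPSol d₁ d₂ α T f₁ f₂) (hT : 0 < T) :
    dIoc T f₁ 0 = 0 := by
  obtain ⟨hf₁, -, heven, -⟩ := h
  have hnhds : Ioc (-T) T ∈ 𝓝 (0 : ℝ) := Ioc_mem_nhds (by linarith) hT
  refine hasDerivAt_zero_of_even ((hasDerivWithinAt_dIoc hf₁ (mem_of_mem_nhds hnhds)).hasDerivAt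
    hnhds) ?_
  filter_upwards [Ioo_mem_nhds (show -T < 0 by linarith) hT] with t ht using heven t ht

theorem EinsteinIVPSol.map_zero (h : EinsteinIVPSol d₁ d₂ α T f₁ f₂) (hT : 0 < T) : f₂ 0 = 0 := by
  obtain ⟨-, -, -, hodd, -⟩ := h
  have := hodd 0 ⟨by linarith, hT⟩
  rw [neg_zero] at this
  linarith

theorem EinsteinIVPSol.Zfun_zero (h : EinsteinIVPSol d₁ d₂ α T f₁ f₂) (hT : 0 < T) :
    Zfun d₁ d₂ T f₁ f₂ 0 = 0 := by
  rw [Zfun, h.dIoc_zero hT, h.map_zero hT]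
  simp

theorem EinsteinIVPSol.continuousOn_curvature (h : EinsteinIVPSol d₁ d₂ α T f₁ f₂) (hT : 0 < T) :
    ContinuousOn (fun t => ((d₁ : ℝ) - 1) / f₁ t ^ 2) (Icc 0 T) := by
  obtain ⟨hf₁, -, -, -, hpos₁, -⟩ := h
  exact continuousOn_const.div
    ((hf₁.continuousOn.mono (fun t ht => ⟨by linarith [ht.1], ht.2⟩)).pow 2)
    fun t ht => pow_ne_zero 2 (hpos₁ t ht).ne'

theorem EinsteinIVPSol.continuousOn_logDeriv (h : EinsteinIVPSol d₁ d₂ α T f₁ f₂) (hT : 0 < T) :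
    ContinuousOn (fun t => dIoc T f₁ t / f₁ t) (Icc 0 T) := by
  obtain ⟨hf₁, -, -, -, hpos₁, -⟩ := h
  have hsub : Icc 0 T ⊆ Ioc (-T) T := fun t ht => ⟨by linarith [ht.1], ht.2⟩
  exact ((contDiffOn_dIoc hf₁).continuousOn.mono hsub).div (hf₁.continuousOn.mono hsub)
    fun t ht => (hpos₁ t ht).ne'

theorem EinsteinIVPSol.continuousOn_meanCurvature_sub (h : EinsteinIVPSol d₁ d₂ α T f₁ f₂)
    (hd₂ : 0 < d₂) (hT : 0 < T) :
    ContinuousOn (fun t => Zfun d₁ d₂ T f₁ f₂ t - d₂ / t) (Icc 0 T) := by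
  intro t ht
  rcases eq_or_lt_of_le ht.1 with h0 | h0
  · subst h0
    have hZ0 := h.Zfun_zero hT
    have hlog := h.continuousOn_logDeriv hT 0 (left_mem_Icc.2 hT.le)
    have hf₂0 := h.map_zero hT
    have hf₁0 := h.dIoc_zero hT
    obtain ⟨-, hf₂, -, hodd, -, -, -, hf₂', -⟩ := h
    have hIoo : Ioo (-T) T ∈ 𝓝 (0 : ℝ) := Ioo_mem_nhds (by linarith) hT
    have hmem : ∀ s ∈ Ioo (-T) T, Ioc (-T) T ∈ 𝓝 s := fun s hs => Ioc_mem_nhds hs.1 hs.2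
    have hd : ∀ {g : ℝ → ℝ}, ContDiffOn ℝ ∞ g (Ioc (-T) T) →
        ∀ᶠ s in 𝓝 0, HasDerivAt g (dIoc T g s) s := by
      intro g hg
      filter_upwards [hIoo] with s hs
      exact (hasDerivWithinAt_dIoc hg (Ioo_subset_Ioc_self hs)).hasDerivAt (hmem s hs)
    have hs₂ := contDiffOn_dIoc hf₂
    have hss₂ := contDiffOn_dIoc hs₂
    have h2 : dIoc T (dIoc T f₂) 0 = 0 := by
      refine hasDerivAt_zero_of_even (hd hs₂).self_of_nhds ?_
      filter_upwards [hIoo] with s hs using dIoc_even_of_odd hodd s hs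
    have h2c : Tendsto (dIoc T (dIoc T f₂)) (𝓝[>] 0) (𝓝 0) := by
      have := (hss₂.continuousOn.continuousAt (hmem 0 (mem_of_mem_nhds hIoo))).tendsto
      rw [h2] at this
      exact this.mono_left nhdsWithin_le_nhds
    have h3 := tendsto_deriv_div_sub_inv hf₂0 hf₂' (hd hf₂) (hd hs₂) h2c
    have h4 : Tendsto (fun t => dIoc T f₁ t / f₁ t) (𝓝[>] 0) (𝓝 0) := by
      have h5 := hlog.tendsto
      simp only [hf₁0, zero_div] at h5
      refine h5.mono_left ?_
      rw [← nhdsWithin_Ioc_eq_nhdsGT hT]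
      exact nhdsWithin_mono _ Ioc_subset_Icc_self
    have h5 : Tendsto (fun t => Zfun d₁ d₂ T f₁ f₂ t - d₂ / t) (𝓝[>] 0) (𝓝 0) := by
      have h6 := (h4.const_mul (d₁ : ℝ)).add (h3.const_mul (d₂ : ℝ))
      rw [mul_zero, mul_zero, add_zero] at h6
      refine h6.congr fun s => ?_
      rw [Zfun]
      ring
    have h6 : ContinuousWithinAt (fun t => Zfun d₁ d₂ T f₁ f₂ t - d₂ / t) (Ioi 0) 0 := by
      rw [ContinuousWithinAt, hZ0, div_zero, sub_zero]
      exact h5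
    exact (continuousWithinAt_Ioi_iff_Ici.1 h6).mono Icc_subset_Ici_self
  · have h1 := (h.isEinsteinCurveAt hd₂ t ⟨h0, ht.2⟩).2.2.continuousWithinAt
    have h2 : ContinuousWithinAt (Zfun d₁ d₂ T f₁ f₂) (Icc 0 T) t := by
      refine h1.mono_of_mem_nhdsWithin ?_
      filter_upwards [self_mem_nhdsWithin, mem_nhdsWithin_of_mem_nhds (Ioi_mem_nhds h0)]
        with s hs hs' using ⟨hs', hs.2⟩
    exact h2.sub (continuousWithinAt_const.div continuousWithinAt_id h0.ne')

end EinsteinIVPSol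

theorem eq_of_div_sq_eq {c x y : ℝ} (hc : c ≠ 0) (hx : 0 < x) (hy : 0 < y)
    (h : c / x ^ 2 = c / y ^ 2) : x = y := by
  rw [div_eq_div_iff (by positivity) (by positivity)] at h
  exact ((pow_left_inj₀ hy.le hx.le two_ne_zero).1 (mul_left_cancel₀ hc h)).symm

theorem EinsteinIVPSol.unique {d₁ d₂ : ℕ} (hd₁ : 2 ≤ d₁) (hd₂ : 2 ≤ d₂) {α : ℝ} (hα : 0 < α)
    {T T' : ℝ} (hT : 0 < T) (hT' : 0 < T') {f₁ f₂ f₁' f₂' : ℝ → ℝ}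
    (h : EinsteinIVPSol d₁ d₂ α T f₁ f₂) (h' : EinsteinIVPSol d₁ d₂ α T' f₁' f₂') :
    T' = T ∧ ∀ t ∈ Ioc (-T) T, f₁' t = f₁ t ∧ f₂' t = f₂ t := by
  have hp2 : (2 : ℝ) ≤ d₁ := by exact_mod_cast hd₁
  have hq2 : (2 : ℝ) ≤ d₂ := by exact_mod_cast hd₂
  have hd₂' : 0 < d₂ := by omega
  have hτ : 0 < min T T' := lt_min hT hT'
  have hs : Ioc 0 (min T T') ⊆ Ioc 0 T := Ioc_subset_Ioc_right (min_le_left _ _)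
  have hs' : Ioc 0 (min T T') ⊆ Ioc 0 T' := Ioc_subset_Ioc_right (min_le_right _ _)
  have hc : Icc 0 (min T T') ⊆ Icc 0 T := Icc_subset_Icc_right (min_le_left _ _)
  have hc' : Icc 0 (min T T') ⊆ Icc 0 T' := Icc_subset_Icc_right (min_le_right _ _)
  obtain ⟨eX, ea, eZ⟩ := eqOn_of_isEinsteinCurveAt (p := d₁) (q := d₂) (by linarith) (by linarith)
    hτ.le
    (fun t ht => (h.isEinsteinCurveAt hd₂' t (hs ht)).congr_mono hs ht (eqOn_refl _ _)
      (eqOn_refl _ _) (eqOn_refl _ _))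
    (fun t ht => (h'.isEinsteinCurveAt hd₂' t (hs' ht)).congr_mono hs' ht (eqOn_refl _ _)
      (eqOn_refl _ _) (eqOn_refl _ _))
    ((h.continuousOn_curvature hT).mono hc) ((h.continuousOn_logDeriv hT).mono hc)
    ((h.continuousOn_meanCurvature_sub hd₂' hT).mono hc)
    ((h'.continuousOn_curvature hT').mono hc') ((h'.continuousOn_logDeriv hT').mono hc')
    ((h'.continuousOn_meanCurvature_sub hd₂' hT').mono hc')
    (by simp only [h.curvature_zero hd₁ hα, h'.curvature_zero hd₁ hα])
    (by simp only [h.dIoc_zero hT, h'.dIoc_zero hT', zero_div])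
    (by rw [h.Zfun_zero hT, h'.Zfun_zero hT'])
  have hY := h.secondCurvature_eq hd₂'
  have hY' := h'.secondCurvature_eq hd₂'
  have h₂0 := h.map_zero hT
  have h₂0' := h'.map_zero hT'
  obtain ⟨-, -, heven, hodd, hpos₁, hpos₂, h₁0, -, -, hZpos, hZT⟩ := h
  obtain ⟨-, -, heven', hodd', hpos₁', hpos₂', h₁0', -, -, hZpos', hZT'⟩ := h'
  have hTT : T' = T := by
    rcases lt_trichotomy T T' with hlt | heq | hlt
    · have h1 := eZ ⟨hT, by simp [hlt.le]⟩
      rw [hZT] at h1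
      exact absurd h1 (hZpos' T ⟨hT, hlt⟩).ne
    · exact heq.symm
    · have h1 := eZ ⟨hT', by simp [hlt.le]⟩
      rw [hZT'] at h1
      exact absurd h1.symm (hZpos T' ⟨hT', hlt⟩).ne
  subst hTT
  rw [min_self] at eX ea eZ
  have hpos : ∀ t ∈ Ioc 0 T', f₁' t = f₁ t ∧ f₂' t = f₂ t := by
    intro t ht
    constructor
    · exact eq_of_div_sq_eq (by linarith : (d₁ : ℝ) - 1 ≠ 0) (hpos₁' t ⟨ht.1.le, ht.2⟩)
        (hpos₁ t ⟨ht.1.le, ht.2⟩) (eX ht).symm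
    · refine eq_of_div_sq_eq (by linarith : (d₂ : ℝ) - 1 ≠ 0) (hpos₂' t ht) (hpos₂ t ht) ?_
      rw [← hY t ht, ← hY' t ht]
      have e1 := eX ht
      have e2 := ea ht
      simp only [] at e1 e2
      simp only [secondCurvature, e1, e2, eZ ht]
  refine ⟨rfl, fun t ht => ?_⟩
  rcases lt_trichotomy t 0 with h0 | h0 | h0
  · have hmem : -t ∈ Ioo (-T') T' := ⟨by linarith, by linarith [ht.1]⟩
    obtain ⟨e1, e2⟩ := hpos (-t) ⟨by linarith, hmem.2.le⟩
    have e3 := heven (-t) hmem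
    have e4 := heven' (-t) hmem
    have e5 := hodd (-t) hmem
    have e6 := hodd' (-t) hmem
    rw [neg_neg] at e3 e4 e5 e6
    exact ⟨by rw [e3, e4, e1], by rw [e5, e6, e2]⟩
  · rw [h0, h₁0, h₁0', h₂0, h₂0']
    exact ⟨rfl, rfl⟩
  · exact hpos t ⟨h0, ht.2⟩

end EinsteinSystem

/-- Proposition `IVPf`: for `d₁, d₂ ≥ 2`, `λ = d₁ + d₂`, and each `α > 0`, there exist a
unique stopping time `tα > 0` and a unique pair of functions solving the singular initial
value problem on `(−tα, tα]` with the stopping condition at `tα`. -/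
theorem einstein_singular_ivp_existence_uniqueness
    (d₁ d₂ : ℕ) (hd₁ : 2 ≤ d₁) (hd₂ : 2 ≤ d₂) (α : ℝ) (hα : 0 < α) :
    ∃ tα : ℝ, 0 < tα ∧ ∃ f₁ f₂ : ℝ → ℝ,
      EinsteinIVPSol d₁ d₂ α tα f₁ f₂ ∧
      ∀ tα' : ℝ, 0 < tα' → ∀ f₁' f₂' : ℝ → ℝ,
        EinsteinIVPSol d₁ d₂ α tα' f₁' f₂' →
          tα' = tα ∧ ∀ t ∈ Set.Ioc (-tα) tα, f₁' t = f₁ t ∧ f₂' t = f₂ t := by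
  obtain ⟨T, hT, f₁, f₂, h⟩ := exists_einsteinIVPSol hd₁ hd₂ hα
  exact ⟨T, hT, f₁, f₂, h, fun _ hT' _ _ h' => h.unique hd₁ hd₂ hα hT hT' h'⟩
end
end
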